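/- Fix an integer r ≥ 2. For every n ≥ 4, the element x_n of ℚ(x_1,x_2) satisfies x_n = x_1^{−c_{n−1}} · x_2^{−c_{n−2}} · Σ_{β ∈ F(D_n)} x_1^{r·|β|_1} · x_2^{r·(c_{n−1}−|β|_2)}. -/

import Mathlib

open scoped Classical

namespace CF

noncomputable section

/-- The sequence `c` : `c 1 = 0`, `c 2 = 1`, `c n = r * c (n-1) - c (n-2)`.
(The value `c 0 = -1` is the unique value consistent with the recurrence.) -/
def c (r : ℕ) : ℕ → ℤ
  | 0 => -1
  | 1 => 0
  | n + 2 => (r : ℤ) * c r (n + 1) - c r n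

/-- `c` as a natural number (valid for indices `≥ 1` when `r ≥ 2`). -/
def cN (r n : ℕ) : ℕ := (c r n).toNat

/-- Height (y-coordinate) of the vertex `w_k` of the maximal Dyck path `D_n`:
the maximal Dyck path from `(0,0)` to `(c_{n-1}-c_{n-2}, c_{n-2})` weakly below the
diagonal has `w_k = (k - ⌊k·c_{n-2}/c_{n-1}⌋, ⌊k·c_{n-2}/c_{n-1}⌋)`. -/
def hgt (r n k : ℕ) : ℕ := k * cN r (n - 2) / cN r (n - 1)

/-- The edge `α_j` of `D_n` is vertical (a north step). -/
def isVert (r n j : ℕ) : Prop := hgt r n (j - 1) < hgt r n j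

/-- Index in the vertex sequence `w_0, …, w_{c_{n-1}}` of the vertex `v_j`
(the upper endpoint of the `j`-th vertical edge); `vpos r n 0 = 0`. -/
def vpos (r n j : ℕ) : ℕ := (j * cN r (n - 1) + cN r (n - 2) - 1) / cN r (n - 2)

/-- x-coordinate of the vertex `v_j` of `D_n` (its y-coordinate is `j`). -/
def vx (r n j : ℕ) : ℤ := (vpos r n j : ℤ) - (j : ℤ)

/-- The slope `s_{i,t}` between `v_i` and `v_t` is at most the slope `s` of the diagonal,
expressed by cross-multiplication. -/
def slopeLE (r n i t : ℕ) : Prop :=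
  ((t : ℤ) - (i : ℤ)) * (c r (n - 1) - c r (n - 2)) ≤ (vx r n t - vx r n i) * c r (n - 2)

/-- `{t | i < t ≤ k, s_{i,t} > s}`. -/
def badSet (r n i k : ℕ) : Finset ℕ :=
  (Finset.Icc (i + 1) k).filter fun t => ¬ slopeLE r n i t

/-- `α(i,k)` is blue: `s_{i,t} ≤ s` for all `i < t ≤ k`. -/
def isBlue (r n i k : ℕ) : Prop := badSet r n i k = ∅

/-- `t₀` is the minimum of `{t | i < t ≤ k, s_{i,t} > s}`. -/
def minBad (r n i k t₀ : ℕ) : Prop :=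
  t₀ ∈ badSet r n i k ∧ ∀ t ∈ badSet r n i k, t₀ ≤ t

/-- `α(i,k)` is `(m,w)`-green: the minimum `t₀` of `{t | i < t ≤ k, s_{i,t} > s}` exists and
equals `i + c_m - w·c_{m-1}`, with `3 ≤ m ≤ n-2` and `1 ≤ w < r-1`. -/
def isGreenMW (r n i k m w : ℕ) : Prop :=
  3 ≤ m ∧ m + 2 ≤ n ∧ 1 ≤ w ∧ (w : ℤ) < (r : ℤ) - 1 ∧
    ∃ t₀ : ℕ, minBad r n i k t₀ ∧ (t₀ : ℤ) = (i : ℤ) + (c r m - (w : ℤ) * c r (m - 1))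

def isGreen (r n i k : ℕ) : Prop := ∃ m w, isGreenMW r n i k m w

/-- `α(i,k)` is red: neither blue nor green. -/
def isRed (r n i k : ℕ) : Prop := ¬ isBlue r n i k ∧ ¬ isGreen r n i k

/-- An element of `P(D_n)`: either a single edge `α_j` (`Sum.inl j`) or a subpath
`α(i,k)` (`Sum.inr (i,k)`). -/
abbrev Elt := ℕ ⊕ ℕ × ℕ

/-- The set of (indices of) edges of `D_n` constituting an element of `P(D_n)`:
a single edge; for `α(i,k)`, the edges from `v_i` (or from its immediate predecessor,
in the red case) to `v_k`. -/
def edges (r n : ℕ) : Elt → Finset ℕ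
  | Sum.inl j => {j}
  | Sum.inr (i, k) =>
      if isRed r n i k then Finset.Icc (vpos r n i) (vpos r n k)
      else Finset.Icc (vpos r n i + 1) (vpos r n k)

/-- Validity of an element of `P(D_n)`: `1 ≤ j ≤ c_{n-1}` for a single edge,
`0 ≤ i < k ≤ c_{n-2}` for a subpath `α(i,k)`. -/
def validElt (r n : ℕ) : Elt → Prop
  | Sum.inl j => 1 ≤ j ∧ (j : ℤ) ≤ c r (n - 1)
  | Sum.inr (i, k) => i < k ∧ (k : ℤ) ≤ c r (n - 2)

/-- The common conditions on a collection `β = {β_1,…,β_t}` of elements of `P(D_n)`: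
all elements are valid, distinct elements share no edge, and for any two subpaths
`α(i,k)`, `α(i',k')` one has `i ≠ k'` and `i' ≠ k`. -/
def validColl (r n : ℕ) (β : Finset Elt) : Prop :=
  (∀ p ∈ β, validElt r n p) ∧
  (∀ p ∈ β, ∀ q ∈ β, p ≠ q → Disjoint (edges r n p) (edges r n q)) ∧
  (∀ i k i' k' : ℕ, Sum.inr (i, k) ∈ β → Sum.inr (i', k') ∈ β → i ≠ k' ∧ i' ≠ k)

/-- The `c_{m-1} - w·c_{m-2}` edges of `D_n` immediately preceding the vertex `v_i`. -/
def precEdges (r n i m w : ℕ) : Finset ℕ :=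
  Finset.Icc (vpos r n i + 1 - (c r (m - 1) - (w : ℤ) * c r (m - 2)).toNat) (vpos r n i)

/-- The set `F(D_n)`. -/
def FD (r n : ℕ) : Set (Finset Elt) :=
  {β | validColl r n β ∧
    ∀ i k m w : ℕ, Sum.inr (i, k) ∈ β → isGreenMW r n i k m w →
      ∃ e ∈ precEdges r n i m w, ∃ p ∈ β, e ∈ edges r n p}

/-- The set `F̃(D_n)`. -/
def Ftilde (r n : ℕ) : Set (Finset Elt) := {β | validColl r n β}

/-- The set `T^{≥u}(D_n)`. -/
def Tge (r n u : ℕ) : Set (Finset Elt) :=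
  {β | validColl r n β ∧ β.Nonempty ∧
    ∃ i k m w : ℕ, u ≤ m ∧ Sum.inr (i, k) ∈ β ∧ isGreenMW r n i k m w ∧
      ∀ e ∈ precEdges r n i m w, ∀ p ∈ β, e ∉ edges r n p}

/-- `|β_j|_1` for a single element. -/
def wt1 : Elt → ℕ
  | Sum.inl _ => 0
  | Sum.inr (i, k) => k - i

/-- `|β|_1`. -/
def B1 (β : Finset Elt) : ℕ := ∑ p ∈ β, wt1 p

/-- `|β|_2`: the total number of edges in the collection `β`. -/
def B2 (r n : ℕ) (β : Finset Elt) : ℕ := (β.biUnion (edges r n)).card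

/-- The field `ℚ(x₁,x₂)`. -/
abbrev K := FractionRing (MvPolynomial (Fin 2) ℚ)

/-- The indeterminate `x₁`. -/
def x₁ : K := algebraMap (MvPolynomial (Fin 2) ℚ) K (MvPolynomial.X 0)

/-- The indeterminate `x₂`. -/
def x₂ : K := algebraMap (MvPolynomial (Fin 2) ℚ) K (MvPolynomial.X 1)

/-- `b_{n-1,k}`: `r` if the edge `α_k` of `D_n` is horizontal, `r-1` if vertical. -/
def bseq (r n k : ℕ) : ℕ := if isVert r n k then r - 1 else r

/-- Prefix sums `S e = Σ_{k=1}^{e} b_{n-1,k}`. -/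
def S (r n e : ℕ) : ℕ := ∑ k ∈ Finset.Icc 1 e, bseq r n k

/-- The interval `[a,b] ⊆ [1,c_n]` is (the edge set of) a blue or green subpath of `D_{n+1}`. -/
def isBGinterval (r n a b : ℕ) : Prop :=
  ∃ i k : ℕ, i < k ∧ (k : ℤ) ≤ c r (n - 1) ∧ ¬ isRed r (n + 1) i k ∧
    Finset.Icc a b = Finset.Icc (vpos r (n + 1) i + 1) (vpos r (n + 1) k)

/-- Left endpoints of the maximal interval components of `V`. -/
def starts (V : Finset ℕ) : Finset ℕ := V.filter fun e => e - 1 ∉ V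

/-- Right endpoint of the maximal interval component of `V` starting at `e`. -/
def compEnd (V : Finset ℕ) (e : ℕ) : ℕ := sSup {g : ℕ | Finset.Icc e g ⊆ V}

/-- `f_i(V)`: the image of the maximal interval component of `V` starting at `e`. -/
def fcomp (r n : ℕ) (V : Finset ℕ) (e : ℕ) : Finset ℕ :=
  if isBGinterval r n (S r n (e - 1) + 1) (S r n (compEnd V e)) then
    Finset.Icc (S r n (e - 1) + 1) (S r n (compEnd V e))
  else
    insert (S r n (e - 1)) (Finset.Icc (S r n (e - 1) + 1) (S r n (compEnd V e)))

/-- The map `f` from subsets of `[1,c_{n-1}]` to subsets of `[1,c_n]`. -/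
def fmap (r n : ℕ) (V : Finset ℕ) : Finset ℕ := (starts V).biUnion (fcomp r n V)

/-- The pull-back `f*` (of the map `f` one level down, from subsets of `[1,c_{n-2}]`
to subsets of `[1,c_{n-1}]`). -/
def fstar (r n : ℕ) (W : Finset ℕ) : Finset ℕ :=
  ((Finset.Icc 1 (cN r (n - 2))).powerset.filter fun U => fmap r (n - 1) U ⊆ W).biUnion id

/-- `δ` of a maximal interval component `[e,g]`: `1` if the `w`-th edge of the corresponding
subpath of `D_n` is vertical for some `2 ≤ w ≤ r-1`, and `0` otherwise. -/
def deltaComp (r n e g : ℕ) : ℕ :=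
  if ∃ w : ℕ, 2 ≤ w ∧ w ≤ r - 1 ∧ e + w - 1 ≤ g ∧ isVert r n (e + w - 1) then 1 else 0

/-- `δ_V`. -/
def deltaV (r n : ℕ) (V : Finset ℕ) : ℕ :=
  ∑ e ∈ starts V, deltaComp r n e (compEnd V e)

/-- Generalized binomial coefficient for integers `A`, `B`. -/
def gbinom (A B : ℤ) : ℚ :=
  if B < 0 then 0
  else (∏ i ∈ Finset.range B.toNat, ((A : ℚ) - (i : ℚ))) / (B.toNat.factorial : ℚ)

/-- `z_n` for `n ≥ 4`, given by the sum over `F̃(D_n)`. -/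
def zF (r n : ℕ) : K :=
  x₁ ^ (-(c r (n - 1))) * x₂ ^ (-(c r (n - 2))) *
    ∑ᶠ β ∈ Ftilde r n,
      x₁ ^ ((r : ℤ) * (B1 β : ℤ)) * x₂ ^ ((r : ℤ) * (c r (n - 1) - (B2 r n β : ℤ)))

/-- `z_n`, with `z_3 = x_3` (the value `x3` is the cluster variable `x_3`). -/
def z (r : ℕ) (x3 : K) (n : ℕ) : K := if n = 3 then x3 else zF r n

end

/-! ### Part 1: the sequence of naturals -/

/-- The natural number sequence `gg j = c_{j+1}`. -/
def gg (r j : ℕ) : ℕ := cN r (j + 1)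

theorem c_pos_aux (r : ℕ) (hr : 2 ≤ r) (j : ℕ) :
    0 ≤ c r (j + 1) ∧ c r (j + 1) < c r (j + 2) := by
  induction j with
  | zero => simp [c]
  | succ j ih =>
    obtain ⟨h1, h2⟩ := ih
    have h3 : c r (j + 1 + 2) = (r : ℤ) * c r (j + 2) - c r (j + 1) := rfl
    have hr' : (2 : ℤ) ≤ r := by exact_mod_cast hr
    refine ⟨by linarith, ?_⟩
    rw [h3]
    nlinarith

theorem gg_cast (r : ℕ) (hr : 2 ≤ r) (j : ℕ) : (gg r j : ℤ) = c r (j + 1) := by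
  have := (c_pos_aux r hr j).1
  simp [gg, cN, Int.toNat_of_nonneg this]

theorem gg_lt (r : ℕ) (hr : 2 ≤ r) (j : ℕ) : gg r j < gg r (j + 1) := by
  have := (c_pos_aux r hr j).2
  zify
  rw [gg_cast r hr, gg_cast r hr]
  exact this

theorem gg_zero (r : ℕ) : gg r 0 = 0 := by simp [gg, cN, c]

theorem gg_one (r : ℕ) : gg r 1 = 1 := by simp [gg, cN, c]

theorem gg_rec (r : ℕ) (hr : 2 ≤ r) (j : ℕ) : gg r (j + 2) + gg r j = r * gg r (j + 1) := by
  zify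
  rw [gg_cast r hr, gg_cast r hr, gg_cast r hr]
  have h3 : c r (j + 2 + 1) = (r : ℤ) * c r (j + 1 + 1) - c r (j + 1) := rfl
  rw [h3]; ring

theorem gg_pos (r : ℕ) (hr : 2 ≤ r) (j : ℕ) : 0 < gg r (j + 1) :=
  lt_of_le_of_lt (Nat.zero_le _) (gg_lt r hr j)

theorem gg_mono (r : ℕ) (hr : 2 ≤ r) {i j : ℕ} (h : i ≤ j) : gg r i ≤ gg r j :=
  (strictMono_nat_of_lt_succ (gg_lt r hr)).monotone h

/-- Determinant identity. -/
theorem c_det (r a e : ℕ) :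
    c r a * c r (a + e + 1) - c r (a + 1) * c r (a + e) = - c r (e + 1) := by
  induction a with
  | zero => simp [c]
  | succ a ih =>
    have h1 : c r (a + 1 + 1) = (r : ℤ) * c r (a + 1) - c r a := rfl
    have h2 : c r (a + 1 + e + 1) = (r : ℤ) * c r (a + e + 1) - c r (a + e) := by
      rw [show a + 1 + e + 1 = (a + e) + 2 by ring]; rfl
    rw [h1, h2, show a + 1 + e = a + e + 1 by ring]
    linarith

/-! ### Part 2: levels. Level `p` corresponds to `n = p + 4`. -/

/-- residue -/
def rho (r p i : ℕ) : ℕ := i * gg r p % gg r (p + 1)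

/-- height in the Dyck path one level down -/
def hh (r p i : ℕ) : ℕ := i * gg r p / gg r (p + 1)

/-- position of the vertex `v_i` -/
def vv (r p i : ℕ) : ℕ := r * i - hh r p i

/-- `t` is the first bad index after `i` -/
def FB (r p i t : ℕ) : Prop :=
  i < t ∧ rho r p t < rho r p i ∧ ∀ s, i < s → s < t → ¬ rho r p s < rho r p i

theorem rho_lt (r : ℕ) (hr : 2 ≤ r) (p i : ℕ) : rho r p i < gg r (p + 1) :=
  Nat.mod_lt _ (gg_pos r hr p)

theorem hh_rho (r p i : ℕ) : hh r p i * gg r (p + 1) + rho r p i = i * gg r p := by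
  unfold hh rho; exact Nat.div_add_mod' _ _

theorem hh_uniq (r p i : ℕ) {a b : ℕ} (hb : b < gg r (p + 1))
    (h : a * gg r (p + 1) + b = i * gg r p) : hh r p i = a ∧ rho r p i = b := by
  unfold hh rho
  rw [← h]
  constructor
  · rw [add_comm, Nat.add_mul_div_right _ _ (by omega), Nat.div_eq_of_lt hb, zero_add]
  · rw [add_comm, Nat.add_mul_mod_self_right, Nat.mod_eq_of_lt hb]

theorem hh_le (r : ℕ) (hr : 2 ≤ r) (p i : ℕ) : hh r p i ≤ i := by
  have h1 := hh_rho r p i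
  have h2 := gg_lt r hr p
  by_contra h
  push Not at h
  nlinarith

theorem vv_hh (r : ℕ) (hr : 2 ≤ r) (p i : ℕ) : vv r p i + hh r p i = r * i := by
  have := hh_le r hr p i
  unfold vv
  have : i ≤ r * i := Nat.le_mul_of_pos_left i (by omega)
  omega

theorem vv_eq (r : ℕ) (hr : 2 ≤ r) (p i : ℕ) :
    vv r p i * gg r (p + 1) = i * gg r (p + 2) + rho r p i := by
  have h1 := hh_rho r p i
  have h2 := vv_hh r hr p i
  have h3 := gg_rec r hr p
  zify at *
  linear_combination (gg r (p+1) : ℤ) * h2 - h1 - (i:ℤ) * h3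

theorem vv_zero (r p : ℕ) : vv r p 0 = 0 := by simp [vv]

theorem rho_zero (r p : ℕ) : rho r p 0 = 0 := by simp [rho]

theorem hh_mono (r p : ℕ) {i j : ℕ} (h : i ≤ j) : hh r p i ≤ hh r p j := by
  unfold hh; gcongr

theorem hh_succ (r : ℕ) (hr : 2 ≤ r) (p i : ℕ) : hh r p (i + 1) ≤ hh r p i + 1 := by
  have h1 := hh_rho r p i
  have h2 := hh_rho r p (i + 1)
  have h3 := gg_lt r hr p
  have h4 := rho_lt r hr p i
  by_contra h
  push Not at h
  nlinarith

theorem vv_lt_succ (r : ℕ) (hr : 2 ≤ r) (p i : ℕ) : vv r p i < vv r p (i + 1) := by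
  have h1 := hh_succ r hr p i
  have h2 := vv_hh r hr p i
  have h3 := vv_hh r hr p (i + 1)
  have : r * (i + 1) = r * i + r := by ring
  omega

theorem vv_strictMono (r : ℕ) (hr : 2 ≤ r) (p : ℕ) : StrictMono (vv r p) :=
  strictMono_nat_of_lt_succ (vv_lt_succ r hr p)

theorem vv_top (r : ℕ) (hr : 2 ≤ r) (p : ℕ) : vv r p (gg r (p + 1)) = gg r (p + 2) := by
  have h1 := vv_eq r hr p (gg r (p + 1))
  have h2 : rho r p (gg r (p + 1)) = 0 := by simp [rho]
  rw [h2] at h1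
  have h3 := gg_pos r hr p
  have : vv r p (gg r (p + 1)) * gg r (p + 1) = gg r (p + 2) * gg r (p + 1) := by
    rw [h1]; ring
  exact Nat.eq_of_mul_eq_mul_right h3 this

theorem hh_vv (r : ℕ) (hr : 2 ≤ r) (p u : ℕ) :
    hh r (p + 1) (vv r p u) = u ∧ rho r (p + 1) (vv r p u) = rho r p u := by
  apply hh_uniq
  · exact lt_trans (rho_lt r hr p u) (gg_lt r hr _)
  · exact (vv_eq r hr p u).symm

/-- `t` is vertical iff its residue is small. -/
theorem vert_of_rho (r : ℕ) (hr : 2 ≤ r) (p t : ℕ) (h : rho r (p + 1) t < gg r (p + 1)) :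
    vv r p (hh r (p + 1) t) = t := by
  have h1 := hh_rho r (p + 1) t
  have h2 := vv_eq r hr p (hh r (p + 1) t)
  have h3 := rho_lt r hr p (hh r (p + 1) t)
  have h4 : vv r p (hh r (p + 1) t) * gg r (p + 1) + rho r (p + 1) t
      = t * gg r (p + 1) + rho r p (hh r (p + 1) t) := by
    change hh r (p + 1) t * gg r (p + 2) + rho r (p + 1) t = t * gg r (p + 1) at h1
    omega
  have := congrArg (· / gg r (p + 1)) h4
  have hg := gg_pos r hr p
  rw [add_comm, Nat.add_mul_div_right _ _ hg, Nat.div_eq_of_lt h, add_comm (t * _),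
    Nat.add_mul_div_right _ _ hg, Nat.div_eq_of_lt h3] at this
  omega

theorem rho_vv_lt (r : ℕ) (hr : 2 ≤ r) (p u : ℕ) : rho r (p + 1) (vv r p u) < gg r (p + 1) := by
  rw [(hh_vv r hr p u).2]; exact rho_lt r hr p u

/-- Galois connection -/
theorem vv_le_iff (r : ℕ) (hr : 2 ≤ r) (p u x : ℕ) : vv r p u ≤ x ↔ u ≤ hh r (p + 1) x := by
  constructor
  · intro h
    have := hh_mono r (p + 1) h
    rwa [(hh_vv r hr p u).1] at this
  · intro h
    have h1 := hh_rho r (p + 1) x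
    have h2 := vv_eq r hr p u
    have h3 := rho_lt r hr p u
    have h4 : gg r (p + 1 + 1) = gg r (p + 2) := rfl
    rw [h4] at h1
    by_contra hx
    push Not at hx
    have h5 : u * gg r (p + 2) ≤ hh r (p + 1) x * gg r (p + 2) := by gcongr
    have h6 : (x + 1) * gg r (p + 1) ≤ vv r p u * gg r (p + 1) := by gcongr; omega
    nlinarith

/-- First bad index from a nonvertical start. -/
theorem FB_nonvert (r : ℕ) (hr : 2 ≤ r) (p i t : ℕ) (hi : gg r (p + 1) ≤ rho r (p + 1) i) :
    FB r (p + 1) i t ↔ t = vv r p (hh r (p + 1) i + 1) := by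
  have hlt : i < vv r p (hh r (p + 1) i + 1) := by
    by_contra h
    push Not at h
    rw [vv_le_iff r hr] at h
    omega
  have hmid : ∀ s, i < s → s < vv r p (hh r (p + 1) i + 1) → rho r (p + 1) i < rho r (p + 1) s := by
    intro s h1 h2
    have h3 : hh r (p + 1) s = hh r (p + 1) i := by
      have h4 := hh_mono r (p + 1) h1.le
      have h5 : ¬ vv r p (hh r (p + 1) i + 1) ≤ s := by omega
      rw [vv_le_iff r hr] at h5
      omega
    have h6 := hh_rho r (p + 1) i
    have h7 := hh_rho r (p + 1) s
    rw [h3] at h7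
    have := gg_pos r hr p
    nlinarith
  have hbad : rho r (p + 1) (vv r p (hh r (p + 1) i + 1)) < rho r (p + 1) i :=
    lt_of_lt_of_le (rho_vv_lt r hr p _) hi
  constructor
  · rintro ⟨h1, h2, h3⟩
    rcases lt_trichotomy t (vv r p (hh r (p + 1) i + 1)) with h | h | h
    · have := hmid t h1 h; omega
    · exact h
    · exact absurd hbad (h3 _ hlt h)
  · rintro rfl
    exact ⟨hlt, hbad, fun s h1 h2 h3 => by have := hmid s h1 h2; omega⟩

/-- First bad index from a vertical start. -/
theorem FB_vert (r : ℕ) (hr : 2 ≤ r) (p i t : ℕ) :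
    FB r (p + 1) (vv r p i) t ↔ ∃ t', t = vv r p t' ∧ FB r p i t' := by
  have hsm := vv_strictMono r hr p
  constructor
  · rintro ⟨h1, h2, h3⟩
    have hv : vv r p (hh r (p + 1) t) = t :=
      vert_of_rho r hr p t (lt_trans h2 (rho_vv_lt r hr p i))
    refine ⟨hh r (p + 1) t, hv.symm, ?_, ?_, ?_⟩
    · rw [← hv] at h1; exact hsm.lt_iff_lt.1 h1
    · rw [← (hh_vv r hr p _).2, ← (hh_vv r hr p i).2, hv]; exact h2
    · intro s hs1 hs2
      have := h3 (vv r p s) (hsm hs1) (by rw [← hv]; exact hsm hs2)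
      rwa [(hh_vv r hr p _).2, (hh_vv r hr p _).2] at this
  · rintro ⟨t', rfl, h1, h2, h3⟩
    refine ⟨hsm h1, ?_, ?_⟩
    · rwa [(hh_vv r hr p _).2, (hh_vv r hr p _).2]
    · intro s hs1 hs2 hs3
      have hv : vv r p (hh r (p + 1) s) = s :=
        vert_of_rho r hr p s (lt_trans hs3 (rho_vv_lt r hr p i))
      rw [← hv] at hs1 hs2 hs3
      rw [(hh_vv r hr p _).2, (hh_vv r hr p _).2] at hs3
      exact h3 _ (hsm.lt_iff_lt.1 hs1) (hsm.lt_iff_lt.1 hs2) hs3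

theorem FB_pos (r p i t : ℕ) (h : FB r p i t) : 1 ≤ i := by
  rcases Nat.eq_zero_or_pos i with rfl | h'
  · have := h.2.1
    rw [rho_zero] at this; omega
  · exact h'

theorem FB_hh_lt (r : ℕ) (p i t : ℕ) (h : FB r p i t) : hh r p i < hh r p t := by
  obtain ⟨h1, h2, h3⟩ := h
  have h4 := hh_rho r p i
  have h5 := hh_rho r p t
  have : i * gg r p ≤ t * gg r p := by gcongr
  by_contra h
  push Not at h
  have : hh r p t * gg r (p + 1) ≤ hh r p i * gg r (p + 1) := by gcongr
  omega

/-- Structure of first bad indices. -/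
theorem FB_struct (r : ℕ) (hr : 2 ≤ r) (p : ℕ) : ∀ i t, FB r p i t →
    ∃ m w : ℕ, 2 ≤ m ∧ m ≤ p + 2 ∧ 1 ≤ w ∧ ((m = 2 ∧ w = 1) ∨ (3 ≤ m ∧ w + 2 ≤ r)) ∧
      (t : ℤ) - i = c r m - w * c r (m - 1) ∧
      (hh r p t : ℤ) - hh r p i = c r (m - 1) - w * c r (m - 2) := by
  induction p with
  | zero =>
    intro i t h
    have h1 := h.2.1
    have := rho_lt r hr 0 i
    rw [show gg r (0 + 1) = 1 from gg_one r] at this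
    omega
  | succ p ih =>
    intro i t h
    by_cases hv : rho r (p + 1) i < gg r (p + 1)
    · have hiv := vert_of_rho r hr p i hv
      rw [← hiv] at h
      rw [FB_vert r hr] at h
      obtain ⟨t', rfl, h⟩ := h
      obtain ⟨m, w, hm, hmp, hw, hcase, hd, hN⟩ := ih _ _ h
      have e1 := vv_hh r hr p t'
      have e2 := vv_hh r hr p (hh r (p + 1) i)
      rw [hiv] at e2
      rw [(hh_vv r hr p t').1]
      zify at e1 e2
      have hd2 : ((vv r p t' : ℕ) : ℤ) - i = r * (c r m - w * c r (m - 1))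
          - (c r (m - 1) - w * c r (m - 2)) := by
        rw [← hd, ← hN]; linarith
      have hgen : ((vv r p t' : ℕ) : ℤ) - i = c r (m + 1) - w * c r m := by
        rw [hd2]
        obtain ⟨m, rfl⟩ : ∃ k, m = k + 2 := ⟨m - 2, by omega⟩
        have a1 : c r (m + 2 + 1) = (r : ℤ) * c r (m + 2) - c r (m + 1) := rfl
        have a2 : c r (m + 2) = (r : ℤ) * c r (m + 1) - c r m := rfl
        rw [a1]
        simp only [Nat.add_sub_cancel, show m + 2 - 1 = m + 1 by omega]
        rw [a2]; ring
      by_cases hr2 : r = 2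
      · subst hr2
        rcases hcase with ⟨rfl, rfl⟩ | ⟨_, h⟩
        · refine ⟨2, 1, le_refl _, by omega, le_refl _, Or.inl ⟨rfl, rfl⟩, ?_, ?_⟩
          · rw [hgen]; norm_num [c]
          · rw [hd]; norm_num [c]
        · omega
      · refine ⟨m + 1, w, by omega, by omega, hw, Or.inr ⟨by omega, ?_⟩, ?_, ?_⟩
        · rcases hcase with ⟨_, h⟩ | ⟨_, h⟩ <;> omega
        · rw [hgen]; rfl
        · rw [hd]; rfl
    · push Not at hv
      rw [FB_nonvert r hr _ _ _ hv] at h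
      have hN : hh r (p + 1) t = hh r (p + 1) i + 1 := by rw [h, (hh_vv r hr p _).1]
      have hlt : i < t := by
        rw [h]; by_contra h'
        push Not at h'
        rw [vv_le_iff r hr] at h'
        omega
      have h1 : vv r p (hh r (p + 1) i) ≤ i := (vv_le_iff r hr _ _ _).2 le_rfl
      have h2 : vv r p (hh r (p + 1) i) ≠ i := by
        intro h2
        have := rho_vv_lt r hr p (hh r (p + 1) i)
        rw [h2] at this; omega
      have e1 := vv_hh r hr p (hh r (p + 1) i)
      have e2 := vv_hh r hr p (hh r (p + 1) i + 1)
      have e3 : hh r p (hh r (p + 1) i) ≤ hh r p (hh r (p + 1) i + 1) := hh_mono r p (by omega)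
      rw [← h] at e2
      have e4 : r * (hh r (p + 1) i + 1) = r * hh r (p + 1) i + r := by ring
      by_cases hd : t = i + 1
      · refine ⟨2, 1, le_refl _, by omega, le_refl _, Or.inl ⟨rfl, rfl⟩, ?_, ?_⟩
        · rw [hd]; simp [c]
        · rw [hN]; simp [c]
      · refine ⟨3, i + r - t, by omega, by omega, by omega, Or.inr ⟨le_rfl, by omega⟩, ?_, ?_⟩
        · rw [Nat.cast_sub (by omega)]; simp [c]; ring
        · rw [hN]; simp [c]

/-- If `t - i = c_m - w c_{m-1}` then the height difference is `c_{m-1} - w c_{m-2}`. -/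
theorem green_N (r : ℕ) (hr : 2 ≤ r) (p i t m w : ℕ) (h : FB r p i t) (hm : 3 ≤ m)
    (hmp : m ≤ p + 2) (hw : 1 ≤ w) (hwr : w + 2 ≤ r)
    (hd : (t : ℤ) - i = c r m - w * c r (m - 1)) :
    (hh r p t : ℤ) - hh r p i = c r (m - 1) - w * c r (m - 2) := by
  obtain ⟨k, rfl⟩ : ∃ k, m = k + 3 := ⟨m - 3, by omega⟩
  obtain ⟨s, rfl⟩ : ∃ s, p = k + 1 + s := ⟨p - (k + 1), by omega⟩
  simp only [show k + 3 - 1 = k + 2 by omega, show k + 3 - 2 = k + 1 by omega] at *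
  have d1 := c_det r (k + 2) s
  have d2 := c_det r (k + 1) (s + 1)
  rw [show k + 2 + s + 1 = k + 1 + s + 1 + 1 by ring, show k + 2 + 1 = k + 3 by ring,
    show k + 2 + s = k + 1 + s + 1 by ring, ← gg_cast r hr (k + 1 + s + 1),
    ← gg_cast r hr (k + 1 + s), ← gg_cast r hr s] at d1
  rw [show k + 1 + (s + 1) + 1 = k + 1 + s + 1 + 1 by ring, show k + 1 + 1 = k + 2 by ring,
    show k + 1 + (s + 1) = k + 1 + s + 1 by ring, ← gg_cast r hr (k + 1 + s + 1),
    ← gg_cast r hr (k + 1 + s), ← gg_cast r hr (s + 1)] at d2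
  have b1 := gg_rec r hr s
  have b2 := gg_lt r hr s
  have b3 : gg r (s + 2) ≤ gg r (k + 1 + s + 1) := gg_mono r hr (by omega)
  have b4 : w * gg r (s + 1) + 2 * gg r (s + 1) ≤ r * gg r (s + 1) := by
    rw [← add_mul]; gcongr
  have b5 : 1 * gg r (s + 1) ≤ w * gg r (s + 1) := by gcongr
  have e1 := hh_rho r (k + 1 + s) i
  have e2 := hh_rho r (k + 1 + s) t
  have e3 := rho_lt r hr (k + 1 + s) i
  have e4 := h.2.1
  zify at *
  set M : ℤ := (gg r (k + 1 + s + 1) : ℤ) with hM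
  set b : ℤ := (gg r (k + 1 + s) : ℤ)
  have key : ((c r (k + 2) - w * c r (k + 1)) - ((hh r (k + 1 + s) t : ℤ) - hh r (k + 1 + s) i)) * M
      = (w * gg r (s + 1) - gg r s)
        - ((rho r (k + 1 + s) i : ℤ) - rho r (k + 1 + s) t) := by
    linear_combination d1 - w * d2 - b * hd - e2 + e1
  set x : ℤ := (c r (k + 2) - w * c r (k + 1)) -
    ((hh r (k + 1 + s) t : ℤ) - hh r (k + 1 + s) i) with hx
  have hM0 : (0 : ℤ) < M := by omega
  have hlt : x * M < M := by omega
  have hgt : -M < x * M := by omega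
  have x1 : x < 1 := by nlinarith
  have x2 : -1 < x := by nlinarith
  omega

theorem gap_arith (X Y M L e f : ℤ) (hM : 0 < M) (hL : 0 < L) (he : 0 ≤ e) (heM : e < M)
    (hf : 0 ≤ f) (hfL : f < L) (key : X * M = Y * L + f - e) : 0 ≤ X ↔ 0 ≤ Y := by
  constructor
  · intro hx
    by_contra hy
    push Not at hy
    have : Y * L ≤ -L := by nlinarith
    have : 0 ≤ X * M := by positivity
    omega
  · intro hy
    by_contra hx
    push Not at hx
    have : X * M ≤ -M := by nlinarith
    have : 0 ≤ Y * L := by positivity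
    omega

set_option maxHeartbeats 1000000 in
/-- The gap lemma. -/
theorem gap (r : ℕ) (hr : 2 ≤ r) (p i t : ℕ) (h : FB r p i t) (e : ℕ) :
    vv r (p + 1) e + (t - i) ≤ vv r (p + 1) (vv r p i) ↔
      e + (hh r p t - hh r p i) ≤ vv r p i := by
  obtain ⟨m, w, hm, hmp, hw, hcase, hd, hN⟩ := FB_struct r hr p i t h
  have hlt := h.1
  have hhlt := FB_hh_lt r p i t h
  have hA := vv_eq r hr (p + 1) e
  have hB := vv_eq r hr (p + 1) (vv r p i)
  have hC := rho_vv_lt r hr p i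
  have hD := rho_lt r hr (p + 1) e
  obtain ⟨k, rfl⟩ : ∃ k, m = k + 2 := ⟨m - 2, by omega⟩
  obtain ⟨s, rfl⟩ : ∃ s, p = k + s := ⟨p - k, by omega⟩
  simp only [show k + 2 - 1 = k + 1 by omega, show k + 2 - 2 = k by omega] at hd hN
  have d1 := c_det r (k + 1) (s + 2)
  have d2 := c_det r k (s + 3)
  rw [show k + 1 + (s + 2) + 1 = k + s + 3 + 1 by ring, show k + 1 + 1 = k + 2 by ring,
    show k + 1 + (s + 2) = k + s + 2 + 1 by ring, ← gg_cast r hr (k + s + 3),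
    ← gg_cast r hr (k + s + 2), ← gg_cast r hr (s + 2)] at d1
  rw [show k + (s + 3) + 1 = k + s + 3 + 1 by ring,
    show k + (s + 3) = k + s + 2 + 1 by ring, ← gg_cast r hr (k + s + 3),
    ← gg_cast r hr (k + s + 2), ← gg_cast r hr (s + 3)] at d2
  have q1 : gg r (k + s + 1) < gg r (k + s + 2) := gg_lt r hr _
  have q2 : gg r (k + s + 2) < gg r (k + s + 3) := gg_lt r hr _
  have q3 : gg r (s + 2) < gg r (s + 3) := gg_lt r hr _
  have q4 : gg r (s + 4) + gg r (s + 2) = r * gg r (s + 3) := gg_rec r hr _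
  have q5 : gg r (k + s + 3) + gg r (k + s + 1) = r * gg r (k + s + 2) := gg_rec r hr _
  -- bounds on the defect
  have hlow : gg r (s + 2) ≤ w * gg r (s + 3) := by
    have : 1 * gg r (s + 3) ≤ w * gg r (s + 3) := by gcongr
    omega
  have hup : w * gg r (s + 3) + rho r (k + s + 1) (vv r (k + s) i)
      < gg r (s + 2) + gg r (k + s + 3) := by
    rcases hcase with ⟨h1, rfl⟩ | ⟨h1, h2⟩
    · obtain rfl : k = 0 := by omega
      simp only [zero_add] at *
      omega
    · have q6 : w * gg r (s + 3) + 2 * gg r (s + 3) ≤ r * gg r (s + 3) := by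
        rw [← add_mul]; gcongr
      obtain ⟨k, rfl⟩ : ∃ l, k = l + 1 := ⟨k - 1, by omega⟩
      rcases Nat.eq_zero_or_pos k with rfl | hk
      · rw [show 0 + 1 + s + 3 = s + 4 by ring, show 0 + 1 + s + 1 = s + 2 by ring] at *
        omega
      · have q7 : gg r (s + 4) ≤ gg r (k + 1 + s + 2) := gg_mono r hr (by omega)
        have q8 : 3 * gg r (k + 1 + s + 2) ≤ r * gg r (k + 1 + s + 2) := by
          gcongr; omega
        omega
  zify [hlt.le, hhlt.le]
  rw [hd, hN]
  have f1 : gg r (k + s + 1 + 1) = gg r (k + s + 2) := rfl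
  have f2 : gg r (k + s + 1 + 2) = gg r (k + s + 3) := rfl
  rw [f1, f2] at hA hB
  rw [f1] at hD
  zify at *
  set M : ℤ := (gg r (k + s + 2) : ℤ)
  set L : ℤ := (gg r (k + s + 3) : ℤ)
  set N : ℤ := c r (k + 2) - w * c r (k + 1) with hNdef
  set N' : ℤ := c r (k + 1) - w * c r k with hN'def
  have hk : N' * L - N * M = w * gg r (s + 3) - gg r (s + 2) := by
    linear_combination d1 - w * d2
  set κ : ℤ := w * gg r (s + 3) - gg r (s + 2)
  set ρ : ℤ := (rho r (k + s + 1) (vv r (k + s) i) : ℤ)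
  set ρe : ℤ := (rho r (k + s + 1) e : ℤ)
  have hρ : 0 ≤ ρ := by positivity
  have hρe : 0 ≤ ρe := by positivity
  have hM0 : 0 < M := by omega
  have hL0 : 0 < L := by omega
  have key : ((vv r (k + s + 1) (vv r (k + s) i) : ℤ) - N - vv r (k + s + 1) e) * M
      = ((vv r (k + s) i : ℤ) - N' - e) * L + (κ + ρ) - ρe := by
    linear_combination hB - hA + hk
  set X : ℤ := (vv r (k + s + 1) (vv r (k + s) i) : ℤ) - N - vv r (k + s + 1) e with hX
  set Y : ℤ := (vv r (k + s) i : ℤ) - N' - e with hY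
  have hκ0 : 0 ≤ κ := by omega
  have hκL : κ + ρ < L := by omega
  have hiff : 0 ≤ X ↔ 0 ≤ Y := gap_arith X Y M L ρe (κ + ρ) hM0 hL0 hρe hD (by omega) hκL key
  constructor
  · intro h1
    have := hiff.1 (by omega)
    omega
  · intro h1
    have := hiff.2 (by omega)
    omega

theorem N_le_vv (r : ℕ) (hr : 2 ≤ r) (p : ℕ) : ∀ i t, FB r p i t →
    hh r p t - hh r p i ≤ vv r p i := by
  induction p with
  | zero =>
    intro i t h
    have h1 := h.2.1
    have := rho_lt r hr 0 i
    rw [show gg r (0 + 1) = 1 from gg_one r] at this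
    omega
  | succ p ih =>
    intro i t h
    by_cases hv : rho r (p + 1) i < gg r (p + 1)
    · have hiv := vert_of_rho r hr p i hv
      rw [← hiv] at h
      rw [FB_vert r hr] at h
      obtain ⟨t', rfl, h⟩ := h
      have h2 := (gap r hr p _ _ h 0).2 (by rw [zero_add]; exact ih _ _ h)
      rw [(hh_vv r hr p t').1]
      rw [hiv, vv_zero, zero_add] at h2
      exact h2
    · push Not at hv
      have hi := FB_pos _ _ _ _ h
      rw [FB_nonvert r hr _ _ _ hv] at h
      rw [h, (hh_vv r hr p _).1]
      have := vv_strictMono r hr (p + 1) (show 0 < i by omega)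
      omega

/-! ### Part 3: a counting lemma -/

/-- Sum over subsets of `G` not containing any of the blocks. -/
noncomputable def blockSum (q : K) (G : Finset ℕ) (J : Finset (ℕ × ℕ)) (P : ℕ × ℕ → Finset ℕ) : K :=
  ∑ E ∈ G.powerset.filter (fun E => ∀ j ∈ J, ¬ P j ⊆ E), q ^ E.card

theorem blockSum_insert (q : K) (G : Finset ℕ) (J : Finset (ℕ × ℕ)) (P : ℕ × ℕ → Finset ℕ)
    (a : ℕ × ℕ) (haG : P a ⊆ G) (hd : ∀ j ∈ J, Disjoint (P j) (P a)) :
    blockSum q G (insert a J) P =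
      (∑ A ∈ (P a).powerset.filter (fun A => A ≠ P a), q ^ A.card) * blockSum q (G \ P a) J P := by
  unfold blockSum
  rw [Finset.sum_mul_sum, ← Finset.sum_product']
  refine Finset.sum_bij' (fun E _ => (E ∩ P a, E \ P a)) (fun x _ => x.1 ∪ x.2) ?_ ?_ ?_ ?_ ?_
  · intro E hE
    simp only [Finset.mem_filter, Finset.mem_powerset, Finset.mem_insert, forall_eq_or_imp] at hE
    simp only [Finset.mem_product, Finset.mem_filter, Finset.mem_powerset]
    refine ⟨⟨Finset.inter_subset_right, fun h => hE.2.1 ?_⟩,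
      Finset.sdiff_subset_sdiff hE.1 le_rfl, fun j hj h => hE.2.2 j hj ?_⟩
    · rw [← h]; exact Finset.inter_subset_left
    · exact h.trans Finset.sdiff_subset
  · rintro ⟨A, B⟩ h
    simp only [Finset.mem_product, Finset.mem_filter, Finset.mem_powerset] at h
    obtain ⟨⟨h1, h2⟩, h3, h4⟩ := h
    simp only [Finset.mem_filter, Finset.mem_powerset, Finset.mem_insert, forall_eq_or_imp]
    refine ⟨Finset.union_subset (h1.trans haG) (h3.trans Finset.sdiff_subset), ?_, ?_⟩
    · intro h
      apply h2
      apply Finset.Subset.antisymm h1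
      intro x hx
      rcases Finset.mem_union.1 (h hx) with h | h
      · exact h
      · exact absurd hx (Finset.mem_sdiff.1 (h3 h)).2
    · intro j hj h
      apply h4 j hj
      intro x hx
      rcases Finset.mem_union.1 (h hx) with h | h
      · exact absurd (h1 h) (Finset.disjoint_left.1 (hd j hj) hx)
      · exact h
  · intro E _
    ext x; simp only [Finset.mem_union, Finset.mem_inter, Finset.mem_sdiff]; tauto
  · rintro ⟨A, B⟩ h
    simp only [Finset.mem_product, Finset.mem_filter, Finset.mem_powerset] at h
    obtain ⟨⟨h1, h2⟩, h3, h4⟩ := h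
    have h5 : ∀ x ∈ B, x ∉ P a := fun x hx => (Finset.mem_sdiff.1 (h3 hx)).2
    refine Prod.ext ?_ ?_
    · ext x; simp only [Finset.mem_union, Finset.mem_inter]
      have := h5 x; have := @h1 x; tauto
    · ext x; simp only [Finset.mem_union, Finset.mem_sdiff]
      have := h5 x; have := @h1 x; tauto
  · intro E _
    rw [← pow_add, Finset.card_inter_add_card_sdiff]

theorem sum_powerset_ne (q : K) (A : Finset ℕ) :
    (∑ B ∈ A.powerset.filter (fun B => B ≠ A), q ^ B.card) = (1 + q) ^ A.card - q ^ A.card := by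
  have h1 : (∑ B ∈ A.powerset, q ^ B.card) = (1 + q) ^ A.card := by
    have := Finset.sum_pow_mul_eq_add_pow q 1 A
    simpa [add_comm] using this
  have h2 : A.powerset.filter (fun B => B ≠ A) = A.powerset.erase A := by
    ext B; simp [Finset.mem_erase, and_comm]
  rw [h2, ← h1, Finset.sum_erase_eq_sub (by simp)]

theorem blockSum_eq (q : K) (J : Finset (ℕ × ℕ)) (P Q : ℕ × ℕ → Finset ℕ) :
    ∀ G H : Finset ℕ, (∀ j ∈ J, P j ⊆ G) → (∀ j ∈ J, Q j ⊆ H) →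
    (∀ i ∈ J, ∀ j ∈ J, i ≠ j → Disjoint (P i) (P j)) →
    (∀ i ∈ J, ∀ j ∈ J, i ≠ j → Disjoint (Q i) (Q j)) →
    (∀ j ∈ J, (P j).card = (Q j).card) →
    blockSum q G J P * (1 + q) ^ H.card = blockSum q H J Q * (1 + q) ^ G.card := by
  induction J using Finset.induction_on with
  | empty =>
    intro G H _ _ _ _ _
    have h1 : ∀ A : Finset ℕ, (∑ B ∈ A.powerset, q ^ B.card) = (1 + q) ^ A.card := by
      intro A
      have := Finset.sum_pow_mul_eq_add_pow q 1 A
      simpa [add_comm] using this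
    simp only [blockSum, Finset.notMem_empty, false_imp_iff, implies_true, Finset.filter_true, h1]
    ring
  | insert a J ha ih =>
    intro G H hP hQ hdP hdQ hc
    have hne : ∀ j ∈ J, j ≠ a := fun j hj h => ha (h ▸ hj)
    have hi : ∀ j ∈ J, j ∈ insert a J := fun j hj => Finset.mem_insert_of_mem hj
    have hai := Finset.mem_insert_self a J
    rw [blockSum_insert q G J P a (hP a hai) fun j hj => hdP j (hi j hj) a hai (hne j hj),
      blockSum_insert q H J Q a (hQ a hai) fun j hj => hdQ j (hi j hj) a hai (hne j hj),
      sum_powerset_ne, sum_powerset_ne]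
    have key := ih (G \ P a) (H \ Q a)
      (fun j hj => Finset.subset_sdiff.2 ⟨hP j (hi j hj), hdP j (hi j hj) a hai (hne j hj)⟩)
      (fun j hj => Finset.subset_sdiff.2 ⟨hQ j (hi j hj), hdQ j (hi j hj) a hai (hne j hj)⟩)
      (fun i hi' j hj' => hdP i (hi i hi') j (hi j hj'))
      (fun i hi' j hj' => hdQ i (hi i hi') j (hi j hj'))
      (fun j hj => hc j (hi j hj))
    have e1 := Finset.card_sdiff_add_card_eq_card (hP a hai)
    have e2 := Finset.card_sdiff_add_card_eq_card (hQ a hai)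
    rw [← e1, ← e2, hc a hai, pow_add, pow_add (1 + q) (G \ P a).card]
    linear_combination ((1 + q) ^ (Q a).card - q ^ (Q a).card) * (1 + q) ^ (Q a).card * key

/-! ### Part 4: compatible pairs and the step identity -/

/-- The compatibility condition. -/
def compat (r p : ℕ) (V E : Finset ℕ) : Prop :=
  (∀ u ∈ V, ∀ e ∈ E, vv r p (u - 1) < e → ¬ e ≤ vv r p u) ∧
  ∀ i t, FB r p i t → i ∉ V → Finset.Ioc i t ⊆ V →
    ¬ Finset.Ioc (vv r p i - (hh r p t - hh r p i)) (vv r p i) ⊆ E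

/-- the block of edges for `j = (i,t)` -/
def Pb (r p : ℕ) (j : ℕ × ℕ) : Finset ℕ :=
  Finset.Ioc (vv r p j.1 - (hh r p j.2 - hh r p j.1)) (vv r p j.1)

/-- the block of verticals one level down -/
def Qb (r p : ℕ) (j : ℕ × ℕ) : Finset ℕ := Finset.Ioc (hh r p j.1) (hh r p j.2)

/-- edges covered by `V` -/
def cov (r p : ℕ) (V : Finset ℕ) : Finset ℕ :=
  V.biUnion fun u => Finset.Ioc (vv r p (u - 1)) (vv r p u)

/-- active blocks -/
noncomputable def Jset (r p : ℕ) (V : Finset ℕ) : Finset (ℕ × ℕ) :=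
  (Finset.range (gg r (p + 1) + 1) ×ˢ Finset.range (gg r (p + 1) + 1)).filter fun j =>
    FB r p j.1 j.2 ∧ j.1 ∉ V ∧ Finset.Ioc j.1 j.2 ⊆ V ∧ Disjoint (Pb r p j) (cov r p V)

theorem mem_Jset (r p : ℕ) (V : Finset ℕ) (hV : V ⊆ Finset.Icc 1 (gg r (p + 1))) (j : ℕ × ℕ) :
    j ∈ Jset r p V ↔
    FB r p j.1 j.2 ∧ j.1 ∉ V ∧ Finset.Ioc j.1 j.2 ⊆ V ∧ Disjoint (Pb r p j) (cov r p V) := by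
  unfold Jset
  rw [Finset.mem_filter]
  constructor
  · exact fun h => h.2
  · intro h
    refine ⟨?_, h⟩
    have h1 := h.1.1
    have h2 := Finset.mem_Icc.1 (hV (h.2.2.1 (Finset.mem_Ioc.2 ⟨h1, le_rfl⟩)))
    simp only [Finset.mem_product, Finset.mem_range]
    omega

theorem compat_iff_block (r p : ℕ) (V : Finset ℕ)
    (hV : V ⊆ Finset.Icc 1 (gg r (p + 1))) (E : Finset ℕ) (hE : E ⊆ Finset.Icc 1 (gg r (p + 2))) :
    compat r p V E ↔ E ⊆ Finset.Icc 1 (gg r (p + 2)) \ cov r p V ∧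
      ∀ j ∈ Jset r p V, ¬ Pb r p j ⊆ E := by
  have hdis : (∀ u ∈ V, ∀ e ∈ E, vv r p (u - 1) < e → ¬ e ≤ vv r p u) ↔ Disjoint E (cov r p V) := by
    rw [Finset.disjoint_left]
    simp only [cov, Finset.mem_biUnion, Finset.mem_Ioc]
    constructor
    · rintro h e he ⟨u, hu, h1, h2⟩
      exact h u hu e he h1 h2
    · intro h u hu e he h1 h2
      exact h he ⟨u, hu, h1, h2⟩
  unfold compat
  rw [hdis, Finset.subset_sdiff]
  constructor
  · rintro ⟨h1, h2⟩
    refine ⟨⟨hE, h1⟩, fun j hj => ?_⟩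
    rw [mem_Jset r p V hV] at hj
    exact h2 _ _ hj.1 hj.2.1 hj.2.2.1
  · rintro ⟨⟨_, h1⟩, h2⟩
    refine ⟨h1, fun i t hfb hi ht hsub => ?_⟩
    by_cases hd : Disjoint (Pb r p (i, t)) (cov r p V)
    · exact h2 (i, t) ((mem_Jset r p V hV _).2 ⟨hfb, hi, ht, hd⟩) hsub
    · exact hd (Finset.disjoint_of_subset_left hsub h1)

theorem compat_iff_block' (r : ℕ) (hr : 2 ≤ r) (p : ℕ) (V : Finset ℕ)
    (hV : V ⊆ Finset.Icc 1 (gg r (p + 2))) (U : Finset ℕ) (hU : U ⊆ Finset.Icc 1 (gg r (p + 1))) :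
    compat r p U (Finset.Icc 1 (gg r (p + 2)) \ V) ↔
      U ⊆ (Finset.Icc 1 (gg r (p + 1))).filter (fun u => vv r p u ∈ V) ∧
      ∀ j ∈ Jset r (p + 1) V, ¬ Qb r (p + 1) j ⊆ U := by
  have hsm := vv_strictMono r hr p
  have hsm' := vv_strictMono r hr (p + 1)
  have hvtop : ∀ u ∈ U, vv r p u ≤ gg r (p + 2) := by
    intro u hu
    rw [← vv_top r hr p]
    exact hsm.monotone (Finset.mem_Icc.1 (hU hu)).2
  -- first condition restated
  have hone : (∀ u ∈ U, ∀ e ∈ Finset.Icc 1 (gg r (p + 2)) \ V, vv r p (u - 1) < e → ¬ e ≤ vv r p u) ↔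
      ∀ u ∈ U, Finset.Ioc (vv r p (u - 1)) (vv r p u) ⊆ V := by
    constructor
    · intro h u hu e he
      rw [Finset.mem_Ioc] at he
      by_contra hev
      refine h u hu e ?_ he.1 he.2
      have := hvtop u hu
      simp only [Finset.mem_sdiff, Finset.mem_Icc]
      exact ⟨⟨by omega, by omega⟩, hev⟩
    · intro h u hu e he h1 h2
      exact (Finset.mem_sdiff.1 he).2 (h u hu (Finset.mem_Ioc.2 ⟨h1, h2⟩))
  unfold compat
  rw [hone]
  constructor
  · rintro ⟨h1, h2⟩
    have hmem : ∀ u ∈ U, vv r p u ∈ V := by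
      intro u hu
      have := Finset.mem_Icc.1 (hU hu)
      exact h1 u hu (Finset.mem_Ioc.2 ⟨hsm (by omega), le_rfl⟩)
    refine ⟨fun u hu => Finset.mem_filter.2 ⟨hU hu, hmem u hu⟩, ?_⟩
    rintro ⟨i, t⟩ hj hsub
    rw [mem_Jset r (p + 1) V hV] at hj
    obtain ⟨hfb, hi, ht, hd⟩ := hj
    simp only at hfb hi ht
    by_cases hv : rho r (p + 1) i < gg r (p + 1)
    · have hiv := vert_of_rho r hr p i hv
      set i' := hh r (p + 1) i with hi'
      rw [← hiv, FB_vert r hr] at hfb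
      obtain ⟨t', rfl, hfb'⟩ := hfb
      have hht := (hh_vv r hr p t').1
      simp only [Qb, hht, ← hi'] at hsub
      have hi'U : i' ∉ U := fun h => hi (hiv ▸ hmem _ h)
      have h3 := h2 i' t' hfb' hi'U hsub
      rw [Finset.not_subset] at h3
      obtain ⟨e, he1, he2⟩ := h3
      rw [hiv, Finset.mem_Ioc] at he1
      have heV : e ∈ V := by
        by_contra hh'
        apply he2
        have : i ≤ gg r (p + 2) := by
          have h4 := hfb'.1
          have h5 := hsm h4
          have h6 := Finset.mem_Icc.1 (hV (ht (Finset.mem_Ioc.2 ⟨hiv ▸ h5, le_rfl⟩)))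
          omega
        simp only [Finset.mem_sdiff, Finset.mem_Icc]
        exact ⟨⟨by omega, by omega⟩, hh'⟩
      have g := gap r hr p i' t' hfb' e
      rw [hiv] at g
      have g2 : ¬ (e + (hh r p t' - hh r p i') ≤ i) := by omega
      rw [← g] at g2
      have hve := hsm' (show 0 < e by omega)
      have hmP : vv r (p + 1) e ∈ Pb r (p + 1) (i, vv r p t') := by
        simp only [Pb, Finset.mem_Ioc, hht, ← hi']
        exact ⟨by omega, hsm'.monotone he1.2⟩
      refine Finset.disjoint_left.1 hd hmP ?_
      · have := Finset.mem_Icc.1 (hV heV)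
        exact Finset.mem_biUnion.2 ⟨e, heV, Finset.mem_Ioc.2 ⟨hsm' (by omega), le_rfl⟩⟩
    · push Not at hv
      have hfb2 := hfb
      rw [FB_nonvert r hr _ _ _ hv] at hfb2
      have hht : hh r (p + 1) t = hh r (p + 1) i + 1 := by rw [hfb2, (hh_vv r hr p _).1]
      have hu : hh r (p + 1) i + 1 ∈ U := hsub (by simp [Qb, hht])
      apply hi
      apply h1 _ hu
      have h3 : vv r p (hh r (p + 1) i) ≤ i := (vv_le_iff r hr _ _ _).2 le_rfl
      have h4 : vv r p (hh r (p + 1) i) ≠ i := by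
        intro h4
        have := rho_vv_lt r hr p (hh r (p + 1) i)
        rw [h4] at this; omega
      have := hfb.1
      simp only [Finset.mem_Ioc, Nat.add_sub_cancel, ← hfb2]
      omega
  · rintro ⟨h1, h2⟩
    have hmem : ∀ u ∈ U, vv r p u ∈ V := fun u hu => (Finset.mem_filter.1 (h1 hu)).2
    have hfirst : ∀ u ∈ U, Finset.Ioc (vv r p (u - 1)) (vv r p u) ⊆ V := by
      intro u hu
      by_contra hns
      set S := (Finset.Ioc (vv r p (u - 1)) (vv r p u)).filter (fun e => e ∉ V) with hS
      have hSne : S.Nonempty := by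
        rw [Finset.not_subset] at hns
        obtain ⟨e, he1, he2⟩ := hns
        exact ⟨e, Finset.mem_filter.2 ⟨he1, he2⟩⟩
      set i := S.max' hSne with hi
      have hiS : i ∈ S := Finset.max'_mem _ _
      rw [hS, Finset.mem_filter, Finset.mem_Ioc] at hiS
      obtain ⟨⟨hi1, hi2⟩, hi3⟩ := hiS
      have hine : i ≠ vv r p u := fun h => hi3 (h ▸ hmem u hu)
      have hu1 := Finset.mem_Icc.1 (hU hu)
      have hhi : hh r (p + 1) i = u - 1 := by
        have a1 : u - 1 ≤ hh r (p + 1) i := (vv_le_iff r hr p _ _).1 hi1.le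
        have a2 : ¬ u ≤ hh r (p + 1) i := by
          rw [← vv_le_iff r hr]; omega
        omega
      have hnv : gg r (p + 1) ≤ rho r (p + 1) i := by
        by_contra hv
        push Not at hv
        have := vert_of_rho r hr p i hv
        rw [hhi] at this
        omega
      have hu2 : u - 1 + 1 = u := by omega
      have hfb : FB r (p + 1) i (vv r p u) := by
        rw [FB_nonvert r hr _ _ _ hnv, hhi, hu2]
      have hIoc : Finset.Ioc i (vv r p u) ⊆ V := by
        intro e he
        rw [Finset.mem_Ioc] at he
        by_contra hev
        have : e ∈ S := Finset.mem_filter.2 ⟨Finset.mem_Ioc.2 ⟨by omega, he.2⟩, hev⟩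
        have := Finset.le_max' S e this
        omega
      refine h2 (i, vv r p u) ((mem_Jset r (p + 1) V hV _).2 ⟨hfb, hi3, hIoc, ?_⟩) ?_
      · rw [Finset.disjoint_left]
        intro x hx hx2
        simp only [Pb, (hh_vv r hr p u).1, hhi, Finset.mem_Ioc] at hx
        obtain ⟨e, he, hx2⟩ := Finset.mem_biUnion.1 hx2
        rw [Finset.mem_Ioc] at hx2
        have hxe : x = vv r (p + 1) i := by omega
        rw [hxe] at hx2
        have b1 := hsm'.lt_iff_lt.1 hx2.1
        have b2 := hsm'.le_iff_le.1 hx2.2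
        have : e = i := by omega
        exact hi3 (this ▸ he)
      · intro x hx
        simp only [Qb, (hh_vv r hr p u).1, hhi, Finset.mem_Ioc] at hx
        have : x = u := by omega
        rwa [this]
    refine ⟨hfirst, ?_⟩
    intro i' t' hfb' hi'U hsub hprec
    have hN := FB_hh_lt r p i' t' hfb'
    have hi1 := FB_pos _ _ _ _ hfb'
    have hv1 : 0 < vv r p i' := by
      have := hsm (show 0 < i' by omega)
      omega
    have hiV : vv r p i' ∉ V := by
      have : vv r p i' ∈ Finset.Icc 1 (gg r (p + 2)) \ V :=
        hprec (Finset.mem_Ioc.2 ⟨by omega, le_rfl⟩)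
      exact (Finset.mem_sdiff.1 this).2
    have hht := (hh_vv r hr p t').1
    have hhi := (hh_vv r hr p i').1
    refine h2 (vv r p i', vv r p t') ((mem_Jset r (p + 1) V hV _).2 ⟨?_, hiV, ?_, ?_⟩) ?_
    · exact (FB_vert r hr p i' _).2 ⟨t', rfl, hfb'⟩
    · intro e he
      simp only [Finset.mem_Ioc] at he
      -- `e` lies in the interval of `u = first vertical at or after e`
      have a1 : i' ≤ hh r (p + 1) (e - 1) := by
        rw [← vv_le_iff r hr]; omega
      have a2 : ¬ t' ≤ hh r (p + 1) (e - 1) := by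
        rw [← vv_le_iff r hr]; omega
      have a3 : vv r p (hh r (p + 1) (e - 1)) ≤ e - 1 := (vv_le_iff r hr _ _ _).2 le_rfl
      have a4 : ¬ vv r p (hh r (p + 1) (e - 1) + 1) ≤ e - 1 := by
        rw [vv_le_iff r hr]; omega
      refine hfirst (hh r (p + 1) (e - 1) + 1) (hsub (Finset.mem_Ioc.2 ⟨by omega, by omega⟩)) ?_
      rw [Finset.mem_Ioc, Nat.add_sub_cancel]
      omega
    · rw [Finset.disjoint_left]
      intro x hx hx2
      simp only [Pb, hht, hhi, Finset.mem_Ioc] at hx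
      obtain ⟨e, he, hx2⟩ := Finset.mem_biUnion.1 hx2
      rw [Finset.mem_Ioc] at hx2
      have b1 : e - 1 < vv r p i' := hsm'.lt_iff_lt.1 (lt_of_lt_of_le hx2.1 hx.2)
      have b2 : ¬ vv r (p + 1) e + (t' - i') ≤ vv r (p + 1) (vv r p i') := by omega
      rw [gap r hr p i' t' hfb' e] at b2
      have b3 := Finset.mem_Icc.1 (hV he)
      have : e ∈ Finset.Icc 1 (gg r (p + 2)) \ V :=
        hprec (Finset.mem_Ioc.2 ⟨by omega, by omega⟩)
      exact (Finset.mem_sdiff.1 this).2 he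
    · simp only [Qb, hht, hhi]
      exact hsub

theorem card_cov (r : ℕ) (hr : 2 ≤ r) (p : ℕ) (V : Finset ℕ)
    (hV : V ⊆ Finset.Icc 1 (gg r (p + 2))) :
    (cov r (p + 1) V).card +
      ((Finset.Icc 1 (gg r (p + 1))).filter (fun u => vv r p u ∈ V)).card = r * V.card := by
  have hsm := vv_strictMono r hr p
  have hsm' := vv_strictMono r hr (p + 1)
  have h1 : (cov r (p + 1) V).card = ∑ u ∈ V, (vv r (p + 1) u - vv r (p + 1) (u - 1)) := by
    unfold cov
    rw [Finset.card_biUnion]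
    · simp
    · intro a _ b _ hab
      change Disjoint (Finset.Ioc _ _) (Finset.Ioc _ _)
      rw [Finset.disjoint_left]
      intro x hx hx2
      rw [Finset.mem_Ioc] at hx hx2
      have a1 := hsm'.lt_iff_lt.1 (lt_of_lt_of_le hx.1 hx2.2)
      have a2 := hsm'.lt_iff_lt.1 (lt_of_lt_of_le hx2.1 hx.2)
      omega
  have h2 : ((Finset.Icc 1 (gg r (p + 1))).filter (fun u => vv r p u ∈ V)).card
      = (V.filter (fun e => vv r p (hh r (p + 1) e) = e)).card := by
    refine Finset.card_bij' (fun u _ => vv r p u) (fun e _ => hh r (p + 1) e) ?_ ?_ ?_ ?_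
    · intro u hu
      rw [Finset.mem_filter] at hu ⊢
      exact ⟨hu.2, by rw [(hh_vv r hr p u).1]⟩
    · intro e he
      rw [Finset.mem_filter] at he ⊢
      have := Finset.mem_Icc.1 (hV he.1)
      refine ⟨Finset.mem_Icc.2 ⟨?_, ?_⟩, by rw [he.2]; exact he.1⟩
      · by_contra h0
        have h0 : hh r (p + 1) e = 0 := by omega
        have h3 := he.2
        rw [h0, vv_zero] at h3
        omega
      · have h3 := he.2
        by_contra h4
        push Not at h4
        have := hsm h4
        rw [vv_top r hr] at this
        omega
    · intro u _
      exact (hh_vv r hr p u).1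
    · intro e he
      exact (Finset.mem_filter.1 he).2
  rw [h1, h2, Finset.card_filter, ← Finset.sum_add_distrib, mul_comm, ← smul_eq_mul,
    ← Finset.sum_const]
  apply Finset.sum_congr rfl
  intro u hu
  have hu1 := Finset.mem_Icc.1 (hV hu)
  obtain ⟨u, rfl⟩ : ∃ k, u = k + 1 := ⟨u - 1, by omega⟩
  rw [Nat.add_sub_cancel]
  have e1 := vv_hh r hr (p + 1) u
  have e2 := vv_hh r hr (p + 1) (u + 1)
  have e3 := hh_succ r hr (p + 1) u
  have e4 := hh_mono r (p + 1) (show u ≤ u + 1 by omega)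
  have e5 : r * (u + 1) = r * u + r := by ring
  have e6 := hsm' (show u < u + 1 by omega)
  split_ifs with h
  · have : ¬ vv r p (hh r (p + 1) (u + 1)) ≤ u := by omega
    rw [vv_le_iff r hr] at this
    omega
  · have : vv r p (hh r (p + 1) (u + 1)) ≤ u + 1 := (vv_le_iff r hr _ _ _).2 le_rfl
    have : vv r p (hh r (p + 1) (u + 1)) ≤ u := by omega
    rw [vv_le_iff r hr] at this
    omega

/-- inner sum over edges -/
noncomputable def SB (r p : ℕ) (q : K) (V : Finset ℕ) : K :=
  ∑ E ∈ (Finset.Icc 1 (gg r (p + 2))).powerset.filter (fun E => compat r p V E), q ^ E.card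

/-- inner sum over verticals -/
noncomputable def SA (r p : ℕ) (q : K) (V : Finset ℕ) : K :=
  ∑ U ∈ (Finset.Icc 1 (gg r (p + 1))).powerset.filter
    (fun U => compat r p U (Finset.Icc 1 (gg r (p + 2)) \ V)), q ^ U.card

theorem cov_subset (r : ℕ) (hr : 2 ≤ r) (p : ℕ) (V : Finset ℕ)
    (hV : V ⊆ Finset.Icc 1 (gg r (p + 1))) : cov r p V ⊆ Finset.Icc 1 (gg r (p + 2)) := by
  intro x hx
  obtain ⟨u, hu, hx⟩ := Finset.mem_biUnion.1 hx
  have h1 := Finset.mem_Icc.1 (hV hu)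
  have h2 := (vv_strictMono r hr p).monotone h1.2
  rw [vv_top r hr] at h2
  rw [Finset.mem_Ioc] at hx
  rw [Finset.mem_Icc]
  omega

theorem step_identity (r : ℕ) (hr : 2 ≤ r) (p : ℕ) (q : K) (hq : 1 + q ≠ 0) (V : Finset ℕ)
    (hV : V ⊆ Finset.Icc 1 (gg r (p + 2))) :
    SB r (p + 1) q V * (1 + q) ^ (r * V.card) = SA r p q V * (1 + q) ^ gg r (p + 3) := by
  have hsm := vv_strictMono r hr p
  have hsm' := vv_strictMono r hr (p + 1)
  set G := Finset.Icc 1 (gg r (p + 3)) \ cov r (p + 1) V with hG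
  set H := (Finset.Icc 1 (gg r (p + 1))).filter (fun u => vv r p u ∈ V) with hH
  have hB : SB r (p + 1) q V = blockSum q G (Jset r (p + 1) V) (Pb r (p + 1)) := by
    unfold SB blockSum
    apply Finset.sum_congr _ fun _ _ => rfl
    ext E
    simp only [Finset.mem_filter, Finset.mem_powerset]
    constructor
    · rintro ⟨h1, h2⟩
      exact (compat_iff_block r (p + 1) V hV E h1).1 h2
    · intro h
      have h1 : E ⊆ Finset.Icc 1 (gg r (p + 3)) := h.1.trans Finset.sdiff_subset
      exact ⟨h1, (compat_iff_block r (p + 1) V hV E h1).2 h⟩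
  have hA : SA r p q V = blockSum q H (Jset r (p + 1) V) (Qb r (p + 1)) := by
    unfold SA blockSum
    apply Finset.sum_congr _ fun _ _ => rfl
    ext U
    simp only [Finset.mem_filter, Finset.mem_powerset]
    constructor
    · rintro ⟨h1, h2⟩
      exact (compat_iff_block' r hr p V hV U h1).1 h2
    · intro h
      have h1 : U ⊆ Finset.Icc 1 (gg r (p + 1)) := h.1.trans (Finset.filter_subset _ _)
      exact ⟨h1, (compat_iff_block' r hr p V hV U h1).2 h⟩
  have hcov := cov_subset r hr (p + 1) V hV
  have hGc := Finset.card_sdiff_add_card_eq_card hcov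
  have hHc := card_cov r hr p V hV
  have ordJ : ∀ i ∈ Jset r (p + 1) V, ∀ j ∈ Jset r (p + 1) V, i.1 < j.1 → i.2 < j.1 := by
    intro i hi j hj hij
    rw [mem_Jset r (p + 1) V hV] at hi hj
    by_contra h
    push Not at h
    exact hj.2.1 (hi.2.2.1 (Finset.mem_Ioc.2 ⟨hij, h⟩))
  have neJ : ∀ i ∈ Jset r (p + 1) V, ∀ j ∈ Jset r (p + 1) V, i ≠ j → i.1 < j.1 ∨ j.1 < i.1 := by
    intro i hi j hj hij
    rw [mem_Jset r (p + 1) V hV] at hi hj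
    rcases lt_trichotomy i.1 j.1 with h | h | h
    · exact Or.inl h
    · exfalso
      apply hij
      refine Prod.ext h ?_
      have f1 := hi.1
      have f2 := hj.1
      rw [← h] at f2
      rcases lt_trichotomy i.2 j.2 with h' | h' | h'
      · exact absurd f1.2.1 (f2.2.2 _ f1.1 h')
      · exact h'
      · exact absurd f2.2.1 (f1.2.2 _ f2.1 h')
    · exact Or.inr h
  have disP : ∀ i ∈ Jset r (p + 1) V, ∀ j ∈ Jset r (p + 1) V, i.1 < j.1 →
      Disjoint (Pb r (p + 1) i) (Pb r (p + 1) j) := by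
    intro i hi j hj hij
    have h1 := ordJ i hi j hj hij
    rw [mem_Jset r (p + 1) V hV] at hi hj
    have h2 : i.1 + 1 ∈ V := hi.2.2.1 (Finset.mem_Ioc.2 ⟨by omega, hi.1.1⟩)
    rw [Finset.disjoint_left]
    intro x hx hx2
    simp only [Pb, Finset.mem_Ioc] at hx hx2
    have h3 : vv r (p + 1) (i.1 + 1) ∈ Pb r (p + 1) j := by
      simp only [Pb, Finset.mem_Ioc]
      have g1 := hsm' (show i.1 < i.1 + 1 by omega)
      have g2 := hsm'.monotone (show i.1 + 1 ≤ j.1 by omega)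
      omega
    refine Finset.disjoint_left.1 hj.2.2.2 h3 ?_
    refine Finset.mem_biUnion.2 ⟨i.1 + 1, h2, Finset.mem_Ioc.2 ⟨?_, le_rfl⟩⟩
    exact hsm' (by omega)
  have disQ : ∀ i ∈ Jset r (p + 1) V, ∀ j ∈ Jset r (p + 1) V, i.1 < j.1 →
      Disjoint (Qb r (p + 1) i) (Qb r (p + 1) j) := by
    intro i hi j hj hij
    have h1 := ordJ i hi j hj hij
    have h2 := hh_mono r (p + 1) h1.le
    rw [Finset.disjoint_left]
    intro x hx hx2
    simp only [Qb, Finset.mem_Ioc] at hx hx2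
    omega
  have key := blockSum_eq q (Jset r (p + 1) V) (Pb r (p + 1)) (Qb r (p + 1)) G H ?_ ?_ ?_ ?_ ?_
  · rw [← hB, ← hA] at key
    rw [Nat.card_Icc, Nat.add_sub_cancel] at hGc
    have e1 : H.card + r * V.card + 0 = r * V.card + H.card := by ring
    have hpow : (1 + q) ^ H.card ≠ 0 := pow_ne_zero _ hq
    have hGc' : G.card + (cov r (p + 1) V).card = gg r (p + 3) := hGc
    have hpow2 : (1 + q) ^ (cov r (p + 1) V).card ≠ 0 := pow_ne_zero _ hq
    rw [← hHc, ← hGc', pow_add, pow_add]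
    linear_combination (1 + q) ^ (cov r (p + 1) V).card * key
  · intro j hj
    rw [mem_Jset r (p + 1) V hV] at hj
    rw [hG, Finset.subset_sdiff]
    refine ⟨?_, hj.2.2.2⟩
    intro x hx
    simp only [Pb, Finset.mem_Ioc] at hx
    have h1 := hj.1.1
    have h2 := Finset.mem_Icc.1 (hV (hj.2.2.1 (Finset.mem_Ioc.2 ⟨h1, le_rfl⟩)))
    have h3 := hsm'.monotone (show j.1 ≤ gg r (p + 2) by omega)
    have h4 : vv r (p + 1) (gg r (p + 2)) = gg r (p + 3) := vv_top r hr (p + 1)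
    rw [Finset.mem_Icc]
    omega
  · intro j hj u hu
    rw [mem_Jset r (p + 1) V hV] at hj
    simp only [Qb, Finset.mem_Ioc] at hu
    have h1 := hj.1.1
    have hvu : vv r p u ∈ V := by
      apply hj.2.2.1
      rw [Finset.mem_Ioc, vv_le_iff r hr]
      refine ⟨?_, hu.2⟩
      by_contra h
      push Not at h
      rw [vv_le_iff r hr] at h
      omega
    refine Finset.mem_filter.2 ⟨Finset.mem_Icc.2 ⟨by omega, ?_⟩, hvu⟩
    have h2 := Finset.mem_Icc.1 (hV hvu)
    rw [← vv_top r hr] at h2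
    exact hsm.le_iff_le.1 h2.2
  · intro i hi j hj hij
    rcases neJ i hi j hj hij with h | h
    · exact disP i hi j hj h
    · exact (disP j hj i hi h).symm
  · intro i hi j hj hij
    rcases neJ i hi j hj hij with h | h
    · exact disQ i hi j hj h
    · exact (disQ j hj i hi h).symm
  · intro j hj
    rw [mem_Jset r (p + 1) V hV] at hj
    have h1 := N_le_vv r hr (p + 1) _ _ hj.1
    simp only [Pb, Qb, Nat.card_Ioc]
    omega

/-! ### Part 5: the induction -/

/-- The sum over compatible pairs. -/
noncomputable def Zs (r p : ℕ) (a b : K) : K :=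
  ∑ V ∈ (Finset.Icc 1 (gg r (p + 1))).powerset, a ^ (r * V.card) * SB r p (b ^ r) V

theorem Zs_swap (r p : ℕ) (a b : K) :
    Zs r p a b = ∑ V ∈ (Finset.Icc 1 (gg r (p + 2))).powerset,
      SA r p (a ^ r) V * b ^ (r * (gg r (p + 2) - V.card)) := by
  unfold Zs SB SA
  simp only [Finset.mul_sum, Finset.sum_mul, Finset.sum_filter]
  rw [Finset.sum_comm]
  refine Finset.sum_bij' (fun E _ => Finset.Icc 1 (gg r (p + 2)) \ E)
    (fun E _ => Finset.Icc 1 (gg r (p + 2)) \ E) ?_ ?_ ?_ ?_ ?_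
  · intro E hE
    simp
  · intro E hE
    simp
  · intro E hE
    exact Finset.sdiff_sdiff_eq_self (Finset.mem_powerset.1 hE)
  · intro E hE
    exact Finset.sdiff_sdiff_eq_self (Finset.mem_powerset.1 hE)
  · intro E hE
    rw [Finset.mem_powerset] at hE
    have hc := Finset.card_sdiff_add_card_eq_card hE
    rw [Nat.card_Icc, Nat.add_sub_cancel] at hc
    apply Finset.sum_congr rfl
    intro U _
    rw [Finset.sdiff_sdiff_eq_self hE]
    split_ifs
    · rw [pow_mul, pow_mul b, show gg r (p + 2) - (Finset.Icc 1 (gg r (p + 2)) \ E).card = E.card by omega]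
    · simp

theorem base_case (r : ℕ) (hr : 2 ≤ r) (a b : K) : Zs r 0 a b = (1 + b ^ r) ^ r + a ^ r := by
  have g1 : gg r (0 + 1) = 1 := gg_one r
  have g2 : gg r (0 + 2) = r := by
    have := gg_rec r hr 0
    rw [gg_zero] at this
    rw [g1] at this; omega
  have hnoFB : ∀ i t, ¬ FB r 0 i t := by
    intro i t h
    have h1 := h.2.1
    have := rho_lt r hr 0 i
    rw [g1] at this
    omega
  have hh0 : ∀ i, vv r 0 i = r * i := by
    intro i; simp [vv, hh, gg_zero]
  have hemp : SB r 0 (b ^ r) ∅ = (1 + b ^ r) ^ r := by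
    have h1 : ∀ E : Finset ℕ, compat r 0 ∅ E := fun E => ⟨by simp, fun i t h => absurd h (hnoFB i t)⟩
    unfold SB
    simp only [h1, Finset.filter_true, g2]
    have := Finset.sum_pow_mul_eq_add_pow (b ^ r) 1 (Finset.Icc 1 r)
    simpa [add_comm] using this
  have hone : SB r 0 (b ^ r) {1} = 1 := by
    unfold SB
    rw [g2]
    have : (Finset.Icc 1 r).powerset.filter (fun E => compat r 0 {1} E) = {∅} := by
      ext E
      simp only [Finset.mem_filter, Finset.mem_powerset, Finset.mem_singleton]
      constructor
      · rintro ⟨h1, h2, _⟩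
        rw [Finset.eq_empty_iff_forall_notMem]
        intro e he
        have h3 := Finset.mem_Icc.1 (h1 he)
        exact h2 1 (by simp) e he (by rw [hh0]; simp; omega) (by rw [hh0]; omega)
      · rintro rfl
        exact ⟨by simp, by simp, fun i t h => absurd h (hnoFB i t)⟩
    rw [this]; simp
  unfold Zs
  rw [g1]
  have : (Finset.Icc 1 1).powerset = {∅, {1}} := by decide
  rw [this, Finset.sum_pair (by simp), hemp, hone]
  simp

theorem main_ind (r : ℕ) (hr : 2 ≤ r) (p : ℕ) : ∀ Y : ℕ → K, (∀ m, Y m ≠ 0) →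
    (∀ m, Y (m + 2) * Y m = Y (m + 1) ^ r + 1) →
    Y (p + 3) * (Y 0 ^ gg r (p + 2) * Y 1 ^ gg r (p + 1)) = Zs r p (Y 0) (Y 1) := by
  induction p with
  | zero =>
    intro Y h0 hrec
    have g1 : gg r (0 + 1) = 1 := gg_one r
    have g2 : gg r (0 + 2) = r := by
      have := gg_rec r hr 0
      rw [gg_zero] at this
      rw [g1] at this; omega
    rw [base_case r hr, g1, g2, pow_one, zero_add]
    have e1 := hrec 0
    have e2 := hrec 1
    simp only [zero_add, Nat.reduceAdd] at e1 e2
    calc Y 3 * (Y 0 ^ r * Y 1) = (Y 3 * Y 1) * Y 0 ^ r := by ring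
      _ = (Y 2 * Y 0) ^ r + Y 0 ^ r := by rw [e2, mul_pow]; ring
      _ = _ := by rw [e1]; ring
  | succ p ih =>
    intro Y h0 hrec
    have IH := ih (fun m => Y (m + 1)) (fun m => h0 _) (fun m => hrec _)
    simp only [zero_add, Nat.reduceAdd] at IH
    rw [Zs_swap] at IH
    have e1 := hrec 0
    simp only [zero_add] at e1
    have hq : 1 + Y 1 ^ r = Y 2 * Y 0 := by rw [e1]; ring
    have hq0 : 1 + Y 1 ^ r ≠ 0 := by rw [hq]; exact mul_ne_zero (h0 _) (h0 _)
    have hg : gg r (p + 3) + gg r (p + 1) = r * gg r (p + 2) := gg_rec r hr (p + 1)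
    have hY2 : Y 2 ^ gg r (p + 1) ≠ 0 := pow_ne_zero _ (h0 _)
    apply mul_left_cancel₀ hY2
    have : Y 2 ^ gg r (p + 1) * (Y (p + 1 + 3) * (Y 0 ^ gg r (p + 1 + 2) * Y 1 ^ gg r (p + 1 + 1)))
        = Y 0 ^ gg r (p + 3) *
          (Y (p + 3 + 1) * (Y 1 ^ gg r (p + 2) * Y 2 ^ gg r (p + 1))) := by
      rw [show p + 1 + 3 = p + 3 + 1 by ring, show p + 1 + 2 = p + 3 by ring,
        show p + 1 + 1 = p + 2 by ring]
      ring
    rw [this, IH]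
    unfold Zs
    rw [Finset.mul_sum, Finset.mul_sum, show p + 1 + 1 = p + 2 by ring]
    apply Finset.sum_congr rfl
    intro V hV
    rw [Finset.mem_powerset] at hV
    have key := step_identity r hr p (Y 1 ^ r) hq0 V hV
    have hc := Finset.card_le_card hV
    rw [Nat.card_Icc, Nat.add_sub_cancel] at hc
    have hY2' : Y 2 ^ (r * V.card) ≠ 0 := pow_ne_zero _ (h0 _)
    apply mul_left_cancel₀ hY2'
    have hexp : r * V.card + r * (gg r (p + 2) - V.card) = gg r (p + 3) + gg r (p + 1) := by
      rw [hg, ← mul_add]; congr 1; omega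
    rw [hq, mul_pow, mul_pow] at key
    have : Y 2 ^ (r * V.card) * (Y 0 ^ gg r (p + 3) *
        (SA r p (Y 1 ^ r) V * Y 2 ^ (r * (gg r (p + 2) - V.card))))
        = Y 0 ^ gg r (p + 3) * SA r p (Y 1 ^ r) V * Y 2 ^ (gg r (p + 3) + gg r (p + 1)) := by
      rw [← hexp, pow_add]; ring
    rw [this, pow_add]
    linear_combination (-(Y 2 ^ gg r (p + 1))) * key

/-! ### Part 5: translation of the Dyck path notions -/

theorem vpos_eq (r : ℕ) (hr : 2 ≤ r) (p j : ℕ) : vpos r (p + 4) j = vv r p j := by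
  change (j * gg r (p + 2) + gg r (p + 1) - 1) / gg r (p + 1) = _
  have h1 := vv_eq r hr p j
  have h2 := rho_lt r hr p j
  apply Nat.div_eq_of_lt_le
  · rw [h1]; omega
  · rw [add_mul, h1]; omega

theorem slopeLE_iff (r : ℕ) (hr : 2 ≤ r) (p i t : ℕ) :
    slopeLE r (p + 4) i t ↔ ¬ rho r p t < rho r p i := by
  have h1 := vv_eq r hr p i
  have h2 := vv_eq r hr p t
  have e1 : c r (p + 4 - 1) = gg r (p + 2) := (gg_cast r hr (p + 2)).symm
  have e2 : c r (p + 4 - 2) = gg r (p + 1) := (gg_cast r hr (p + 1)).symm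
  unfold slopeLE vx
  rw [vpos_eq r hr, vpos_eq r hr, e1, e2]
  zify at h1 h2 ⊢
  have : ((vv r p t : ℤ) - t - (vv r p i - i)) * gg r (p + 1) =
    ((t : ℤ) - i) * (gg r (p + 2) - gg r (p + 1)) + (rho r p t - rho r p i) := by
    linear_combination h2 - h1
  rw [this]
  constructor <;> intro h <;> linarith

theorem mem_badSet (r : ℕ) (hr : 2 ≤ r) (p i k t : ℕ) :
    t ∈ badSet r (p + 4) i k ↔ (i < t ∧ t ≤ k) ∧ rho r p t < rho r p i := by
  simp only [badSet, Finset.mem_filter, Finset.mem_Icc, slopeLE_iff r hr, not_not,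
    Nat.succ_le_iff]

theorem minBad_iff (r : ℕ) (hr : 2 ≤ r) (p i k t : ℕ) :
    minBad r (p + 4) i k t ↔ FB r p i t ∧ t ≤ k := by
  simp only [minBad, mem_badSet r hr, FB]
  constructor
  · rintro ⟨⟨⟨h1, h2⟩, h3⟩, h4⟩
    refine ⟨⟨h1, h3, ?_⟩, h2⟩
    intro s hs hst hlt
    have := h4 s ⟨⟨hs, by omega⟩, hlt⟩
    omega
  · rintro ⟨⟨h1, h3, h4⟩, h2⟩
    refine ⟨⟨⟨h1, h2⟩, h3⟩, ?_⟩
    rintro s ⟨⟨hs, hsk⟩, hlt⟩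
    by_contra hc
    exact h4 s hs (by omega) hlt

theorem FB_unique (r p i t t' : ℕ) (h : FB r p i t) (h' : FB r p i t') : t = t' := by
  rcases lt_trichotomy t t' with h1 | h1 | h1
  · exact absurd h.2.1 (h'.2.2 t h.1 h1)
  · exact h1
  · exact absurd h'.2.1 (h.2.2 t' h'.1 h1)

theorem exists_FB (r : ℕ) (hr : 2 ≤ r) (p i k : ℕ) (h : ¬ isBlue r (p + 4) i k) :
    ∃ t, FB r p i t ∧ t ≤ k := by
  have h1 : (badSet r (p + 4) i k).Nonempty := Finset.nonempty_iff_ne_empty.2 h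
  refine ⟨(badSet r (p + 4) i k).min' h1, (minBad_iff r hr p i k _).1 ⟨Finset.min'_mem _ _, ?_⟩⟩
  intro t ht
  exact Finset.min'_le _ _ ht

theorem red_FB (r : ℕ) (hr : 2 ≤ r) (p i k : ℕ) (h : isRed r (p + 4) i k) :
    ∃ t, FB r p i t ∧ t ≤ k ∧ hh r p t - hh r p i = 1 := by
  obtain ⟨t, ht, htk⟩ := exists_FB r hr p i k h.1
  refine ⟨t, ht, htk, ?_⟩
  obtain ⟨m, w, hm, hmp, hw, hcase, hd, hN⟩ := FB_struct r hr p i t ht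
  rcases hcase with ⟨rfl, rfl⟩ | ⟨h3, hwr⟩
  · simp [c] at hN
    omega
  · exfalso
    apply h.2
    refine ⟨m, w, h3, by omega, hw, by omega, t, (minBad_iff r hr p i k t).2 ⟨ht, htk⟩, ?_⟩
    linarith

theorem green_FB (r : ℕ) (hr : 2 ≤ r) (p i k m w : ℕ) (h : isGreenMW r (p + 4) i k m w) :
    ∃ t, FB r p i t ∧ t ≤ k ∧ precEdges r (p + 4) i m w =
      Finset.Ioc (vv r p i - (hh r p t - hh r p i)) (vv r p i) := by
  obtain ⟨h3, hmn, hw, hwr, t, hmin, ht⟩ := h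
  rw [minBad_iff r hr] at hmin
  refine ⟨t, hmin.1, hmin.2, ?_⟩
  have hN := green_N r hr p i t m w hmin.1 h3 (by omega) hw (by omega) (by linarith)
  have hlt := FB_hh_lt r p i t hmin.1
  have hle := N_le_vv r hr p i t hmin.1
  unfold precEdges
  rw [← hN, vpos_eq r hr]
  ext x
  simp only [Finset.mem_Icc, Finset.mem_Ioc]
  omega

theorem red_or_green (r : ℕ) (hr : 2 ≤ r) (p i k t : ℕ) (h : FB r p i t) (htk : t ≤ k) :
    isRed r (p + 4) i k ∨ ∃ m w, isGreenMW r (p + 4) i k m w := by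
  by_cases hg : isGreen r (p + 4) i k
  · exact Or.inr hg
  · refine Or.inl ⟨?_, hg⟩
    intro hb
    have : t ∈ badSet r (p + 4) i k := ((minBad_iff r hr p i k t).2 ⟨h, htk⟩).1
    rw [show badSet r (p + 4) i k = ∅ from hb] at this
    simp at this

theorem mem_edges_inr (r : ℕ) (hr : 2 ≤ r) (p i k e : ℕ) :
    e ∈ edges r (p + 4) (Sum.inr (i, k)) ↔
      (vv r p i < e ∧ e ≤ vv r p k) ∨
        (isRed r (p + 4) i k ∧ vv r p i = e ∧ e ≤ vv r p k) := by
  unfold edges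
  simp only [vpos_eq r hr]
  split_ifs with h
  · simp only [Finset.mem_Icc, h, true_and]; omega
  · simp only [Finset.mem_Icc, h, false_and, or_false, Nat.succ_le_iff]

theorem mem_edges_inl (r n j e : ℕ) : e ∈ edges r n (Sum.inl j) ↔ e = j := by
  simp [edges]

theorem validElt_inr (r : ℕ) (hr : 2 ≤ r) (p i k : ℕ) :
    validElt r (p + 4) (Sum.inr (i, k)) ↔ i < k ∧ k ≤ gg r (p + 1) := by
  have e2 : c r (p + 4 - 2) = gg r (p + 1) := (gg_cast r hr (p + 1)).symm
  simp only [validElt, e2, Nat.cast_le]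

theorem validElt_inl (r : ℕ) (hr : 2 ≤ r) (p j : ℕ) :
    validElt r (p + 4) (Sum.inl j) ↔ 1 ≤ j ∧ j ≤ gg r (p + 2) := by
  have e2 : c r (p + 4 - 1) = gg r (p + 2) := (gg_cast r hr (p + 2)).symm
  simp only [validElt, e2, Nat.cast_le]

/-- `(i,k]` is a maximal run of `V` -/
def run (V : Finset ℕ) (i k : ℕ) : Prop :=
  i < k ∧ Finset.Ioc i k ⊆ V ∧ i ∉ V ∧ k + 1 ∉ V

theorem run_sep (V : Finset ℕ) {i k i' k' : ℕ} (h : run V i k) (h' : run V i' k')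
    (hne : (i, k) ≠ (i', k')) : k < i' ∨ k' < i := by
  obtain ⟨a1, a2, a3, a4⟩ := h
  obtain ⟨b1, b2, b3, b4⟩ := h'
  rcases lt_trichotomy i i' with hh | hh | hh
  · left
    by_contra hc
    exact b3 (a2 (Finset.mem_Ioc.2 ⟨hh, by omega⟩))
  · subst hh
    exfalso
    rcases lt_trichotomy k k' with h1 | h1 | h1
    · exact a4 (b2 (Finset.mem_Ioc.2 ⟨by omega, by omega⟩))
    · exact hne (by rw [h1])
    · exact b4 (a2 (Finset.mem_Ioc.2 ⟨by omega, by omega⟩))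
  · right
    by_contra hc
    exact a3 (b2 (Finset.mem_Ioc.2 ⟨hh, by omega⟩))

theorem run_extend (V : Finset ℕ) (G i t : ℕ) (hV : V ⊆ Finset.Icc 1 G) (hit : i < t)
    (hi : i ∉ V) (hs : Finset.Ioc i t ⊆ V) : ∃ k, t ≤ k ∧ run V i k := by
  have hex : ∃ k, t ≤ k ∧ k + 1 ∉ V := by
    refine ⟨max t G, le_max_left _ _, ?_⟩
    intro h
    have := (Finset.mem_Icc.1 (hV h)).2
    have := le_max_right t G
    omega
  refine ⟨Nat.find hex, (Nat.find_spec hex).1, ?_, ?_, hi, (Nat.find_spec hex).2⟩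
  · exact lt_of_lt_of_le hit (Nat.find_spec hex).1
  · intro x hx
    rw [Finset.mem_Ioc] at hx
    by_cases hxt : x ≤ t
    · exact hs (Finset.mem_Ioc.2 ⟨hx.1, hxt⟩)
    · have := Nat.find_min hex (show x - 1 < Nat.find hex by omega)
      by_contra hxV
      apply this
      refine ⟨by omega, ?_⟩
      rwa [show x - 1 + 1 = x by omega]

theorem run_exists (V : Finset ℕ) (G v : ℕ) (hV : V ⊆ Finset.Icc 1 G) (hv : v ∈ V) :
    ∃ i k, run V i k ∧ i < v ∧ v ≤ k := by
  have h0 : 0 ∉ V := fun h => by simpa using hV h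
  have hlow : ∀ v, v ∈ V → ∃ i, i < v ∧ i ∉ V ∧ Finset.Ioc i v ⊆ V := by
    intro v
    induction v with
    | zero => intro h; exact absurd h h0
    | succ v ih =>
      intro h
      by_cases hv : v ∈ V
      · obtain ⟨i, h1, h2, h3⟩ := ih hv
        refine ⟨i, by omega, h2, ?_⟩
        intro x hx
        rw [Finset.mem_Ioc] at hx
        rcases eq_or_lt_of_le hx.2 with h4 | h4
        · rw [h4]; exact h
        · exact h3 (Finset.mem_Ioc.2 ⟨hx.1, by omega⟩)
      · refine ⟨v, by omega, hv, ?_⟩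
        intro x hx
        rw [Finset.mem_Ioc] at hx
        rw [show x = v + 1 by omega]; exact h
  obtain ⟨i, h1, h2, h3⟩ := hlow v hv
  obtain ⟨k, h4, h5⟩ := run_extend V G i v hV h1 h2 h3
  exact ⟨i, k, h5, h1, h4⟩

theorem run_le (V : Finset ℕ) (G i k : ℕ) (hV : V ⊆ Finset.Icc 1 G) (h : run V i k) : k ≤ G :=
  (Finset.mem_Icc.1 (hV (h.2.1 (Finset.mem_Ioc.2 ⟨h.1, le_rfl⟩)))).2

/-- vertical steps of an element -/
def eltV : Elt → Finset ℕ
  | Sum.inl _ => ∅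
  | Sum.inr (i, k) => Finset.Ioc i k

/-- vertical steps used by a collection -/
noncomputable def Vof (β : Finset Elt) : Finset ℕ := β.biUnion eltV

/-- edges not used by a collection -/
noncomputable def Eof (r p : ℕ) (β : Finset Elt) : Finset ℕ :=
  Finset.Icc 1 (gg r (p + 2)) \ β.biUnion (edges r (p + 4))

theorem mem_Vof (β : Finset Elt) (v : ℕ) :
    v ∈ Vof β ↔ ∃ i k, Sum.inr (i, k) ∈ β ∧ i < v ∧ v ≤ k := by
  simp only [Vof, Finset.mem_biUnion]
  constructor
  · rintro ⟨q | ⟨i, k⟩, hq, hv⟩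
    · simp [eltV] at hv
    · exact ⟨i, k, hq, Finset.mem_Ioc.1 hv⟩
  · rintro ⟨i, k, h, hv⟩
    exact ⟨_, h, Finset.mem_Ioc.2 hv⟩

theorem valid_inr_run (r : ℕ) (hr : 2 ≤ r) (p : ℕ) (β : Finset Elt)
    (h : validColl r (p + 4) β) (i k : ℕ) (hm : Sum.inr (i, k) ∈ β) : run (Vof β) i k := by
  obtain ⟨h1, h2, h3⟩ := h
  have hsm := vv_strictMono r hr p
  have hik := ((validElt_inr r hr p i k).1 (h1 _ hm)).1
  refine ⟨hik, ?_, ?_, ?_⟩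
  · intro x hx
    exact (mem_Vof β x).2 ⟨i, k, hm, Finset.mem_Ioc.1 hx⟩
  · intro hi
    obtain ⟨i', k', hm', ha, hb⟩ := (mem_Vof β i).1 hi
    have hne := (h3 i k i' k' hm hm').1
    have hd := h2 _ hm _ hm' (by
      intro he
      simp only [Sum.inr.injEq, Prod.mk.injEq] at he
      omega)
    have hd2 := Finset.disjoint_left.1 hd
    refine @hd2 (vv r p (i + 1)) ?_ ?_
    · exact (mem_edges_inr r hr p _ _ _).2 (Or.inl ⟨hsm (by omega), hsm.monotone (by omega)⟩)
    · exact (mem_edges_inr r hr p _ _ _).2 (Or.inl ⟨hsm (by omega), hsm.monotone (by omega)⟩)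
  · intro hk
    obtain ⟨i', k', hm', ha, hb⟩ := (mem_Vof β (k + 1)).1 hk
    have hne := (h3 i k i' k' hm hm').2
    have hd := h2 _ hm _ hm' (by
      intro he
      simp only [Sum.inr.injEq, Prod.mk.injEq] at he
      omega)
    have hd2 := Finset.disjoint_left.1 hd
    refine @hd2 (vv r p k) ?_ ?_
    · exact (mem_edges_inr r hr p _ _ _).2 (Or.inl ⟨hsm (by omega), hsm.monotone (by omega)⟩)
    · exact (mem_edges_inr r hr p _ _ _).2 (Or.inl ⟨hsm (by omega), hsm.monotone (by omega)⟩)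

theorem valid_inr_iff (r : ℕ) (hr : 2 ≤ r) (p : ℕ) (β : Finset Elt)
    (h : validColl r (p + 4) β) (i k : ℕ) : Sum.inr (i, k) ∈ β ↔ run (Vof β) i k := by
  refine ⟨valid_inr_run r hr p β h i k, ?_⟩
  intro hrun
  have h1 : i + 1 ∈ Vof β := hrun.2.1 (Finset.mem_Ioc.2 ⟨by omega, hrun.1⟩)
  obtain ⟨i', k', hm', ha, hb⟩ := (mem_Vof β _).1 h1
  have hrun' := valid_inr_run r hr p β h i' k' hm'
  by_cases he : (i, k) = (i', k')
  · rw [he]; exact hm'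
  · have := hrun.1
    have := run_sep _ hrun hrun' he
    omega

theorem valid_inl_iff (r : ℕ) (hr : 2 ≤ r) (p : ℕ) (β : Finset Elt)
    (h : validColl r (p + 4) β) (j : ℕ) : Sum.inl j ∈ β ↔
      (1 ≤ j ∧ j ≤ gg r (p + 2)) ∧ j ∉ Eof r p β ∧
        ∀ i k, run (Vof β) i k → j ∉ edges r (p + 4) (Sum.inr (i, k)) := by
  constructor
  · intro hj
    refine ⟨(validElt_inl r hr p j).1 (h.1 _ hj), ?_, ?_⟩
    · intro hE
      refine (Finset.mem_sdiff.1 hE).2 (Finset.mem_biUnion.2 ⟨_, hj, ?_⟩)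
      simp [edges]
    · intro i k hrun
      have hm := (valid_inr_iff r hr p β h i k).2 hrun
      have hd := h.2.1 _ hj _ hm (by simp)
      exact Finset.disjoint_left.1 hd (by simp [edges])
  · rintro ⟨hj, hE, hruns⟩
    have : j ∈ β.biUnion (edges r (p + 4)) := by
      by_contra hc
      exact hE (Finset.mem_sdiff.2 ⟨Finset.mem_Icc.2 hj, hc⟩)
    obtain ⟨q | ⟨i, k⟩, hq, hjq⟩ := Finset.mem_biUnion.1 this
    · rw [mem_edges_inl] at hjq
      rw [hjq]; exact hq
    · exact absurd hjq (hruns i k (valid_inr_run r hr p β h i k hq))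

/-- the inverse construction -/
noncomputable def inv (r p : ℕ) (V E : Finset ℕ) : Finset Elt :=
  ((Finset.range (gg r (p + 1) + 1) ×ˢ Finset.range (gg r (p + 1) + 1)).filter
      (fun ik => run V ik.1 ik.2)).image Sum.inr ∪
  ((Finset.Icc 1 (gg r (p + 2))).filter (fun j => j ∉ E ∧
      ∀ i k, run V i k → j ∉ edges r (p + 4) (Sum.inr (i, k)))).image Sum.inl

theorem mem_inv_inr (r p : ℕ) (V E : Finset ℕ) (hV : V ⊆ Finset.Icc 1 (gg r (p + 1)))
    (i k : ℕ) : Sum.inr (i, k) ∈ inv r p V E ↔ run V i k := by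
  simp only [inv, Finset.mem_union, Finset.mem_image, Finset.mem_filter, Finset.mem_product,
    Finset.mem_range, Sum.inr.injEq, reduceCtorEq, and_false, exists_false, or_false]
  constructor
  · rintro ⟨a, ⟨_, h⟩, rfl⟩
    exact h
  · intro h
    have h1 := run_le V _ i k hV h
    have h2 := h.1
    exact ⟨(i, k), ⟨⟨by simp only; omega, by simp only; omega⟩, h⟩, rfl⟩

theorem mem_inv_inl (r p : ℕ) (V E : Finset ℕ) (j : ℕ) : Sum.inl j ∈ inv r p V E ↔
    (1 ≤ j ∧ j ≤ gg r (p + 2)) ∧ j ∉ E ∧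
        ∀ i k, run V i k → j ∉ edges r (p + 4) (Sum.inr (i, k)) := by
  simp only [inv, Finset.mem_union, Finset.mem_image, Finset.mem_filter, Finset.mem_Icc,
    Sum.inl.injEq, reduceCtorEq, and_false, exists_false, false_or, exists_eq_right]

theorem inv_left (r : ℕ) (hr : 2 ≤ r) (p : ℕ) (β : Finset Elt)
    (h : validColl r (p + 4) β) (hV : Vof β ⊆ Finset.Icc 1 (gg r (p + 1))) :
    inv r p (Vof β) (Eof r p β) = β := by
  ext (j | ⟨i, k⟩)
  · rw [mem_inv_inl, valid_inl_iff r hr p β h]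
  · rw [mem_inv_inr _ _ _ _ hV, valid_inr_iff r hr p β h]

theorem Vof_subset (r : ℕ) (hr : 2 ≤ r) (p : ℕ) (β : Finset Elt)
    (h : validColl r (p + 4) β) : Vof β ⊆ Finset.Icc 1 (gg r (p + 1)) := by
  intro v hv
  obtain ⟨i, k, hm, h1, h2⟩ := (mem_Vof β v).1 hv
  have := (validElt_inr r hr p i k).1 (h.1 _ hm)
  rw [Finset.mem_Icc]; omega

theorem compat_of_FD (r : ℕ) (hr : 2 ≤ r) (p : ℕ) (β : Finset Elt)
    (h : β ∈ FD r (p + 4)) : compat r p (Vof β) (Eof r p β) := by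
  obtain ⟨hv, hg⟩ := h
  have hsm := vv_strictMono r hr p
  have hV := Vof_subset r hr p β hv
  constructor
  · intro u hu e he h1 h2
    obtain ⟨i, k, hm, h3, h4⟩ := (mem_Vof β u).1 hu
    refine (Finset.mem_sdiff.1 he).2 (Finset.mem_biUnion.2 ⟨_, hm, ?_⟩)
    refine (mem_edges_inr r hr p _ _ _).2 (Or.inl ⟨?_, ?_⟩)
    · exact lt_of_le_of_lt (hsm.monotone (by omega)) h1
    · exact h2.trans (hsm.monotone h4)
  · intro i t hfb hi hs hsub
    obtain ⟨k, htk, hrun⟩ := run_extend _ _ i t hV hfb.1 hi hs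
    have hm := (valid_inr_iff r hr p β hv i k).2 hrun
    rcases red_or_green r hr p i k t hfb htk with hred | ⟨m, w, hgr⟩
    · have hlt := FB_hh_lt r p i t hfb
      have hpos := FB_pos r p i t hfb
      have hvp := hsm (show 0 < i by omega)
      have : vv r p i ∈ Eof r p β := hsub (Finset.mem_Ioc.2 ⟨by omega, le_rfl⟩)
      refine (Finset.mem_sdiff.1 this).2 (Finset.mem_biUnion.2 ⟨_, hm, ?_⟩)
      exact (mem_edges_inr r hr p _ _ _).2 (Or.inr ⟨hred, rfl, hsm.monotone hrun.1.le⟩)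
    · obtain ⟨e, he, q, hq, heq⟩ := hg i k m w hm hgr
      obtain ⟨t', hfb', _, hprec⟩ := green_FB r hr p i k m w hgr
      rw [hprec, FB_unique r p i t' t hfb' hfb] at he
      exact (Finset.mem_sdiff.1 (hsub he)).2 (Finset.mem_biUnion.2 ⟨_, hq, heq⟩)

theorem inv_cover (r p : ℕ) (V E : Finset ℕ) (hV : V ⊆ Finset.Icc 1 (gg r (p + 1)))
    (j : ℕ) (hj : 1 ≤ j ∧ j ≤ gg r (p + 2)) (hE : j ∉ E) :
    ∃ q ∈ inv r p V E, j ∈ edges r (p + 4) q := by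
  by_cases hc : ∀ i k, run V i k → j ∉ edges r (p + 4) (Sum.inr (i, k))
  · exact ⟨Sum.inl j, (mem_inv_inl r p V E j).2 ⟨hj, hE, hc⟩, by simp [edges]⟩
  · push Not at hc
    obtain ⟨i, k, h1, h2⟩ := hc
    exact ⟨_, (mem_inv_inr r p V E hV i k).2 h1, h2⟩

theorem edges_inr_bounds (r : ℕ) (hr : 2 ≤ r) (p i k e : ℕ)
    (h : e ∈ edges r (p + 4) (Sum.inr (i, k))) : vv r p i ≤ e ∧ e ≤ vv r p k := by
  rw [mem_edges_inr r hr] at h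
  omega

theorem inv_FD (r : ℕ) (hr : 2 ≤ r) (p : ℕ) (V E : Finset ℕ)
    (hV : V ⊆ Finset.Icc 1 (gg r (p + 1))) (hc : compat r p V E) :
    inv r p V E ∈ FD r (p + 4) := by
  have hsm := vv_strictMono r hr p
  have key : ∀ q ∈ inv r p V E, ∀ q' ∈ inv r p V E, q ≠ q' →
      ∀ e, e ∈ edges r (p + 4) q → e ∉ edges r (p + 4) q' := by
    rintro (j | ⟨i, k⟩) hq (j' | ⟨i', k'⟩) hq' hne e he he'
    · rw [mem_edges_inl] at he he'
      exact hne (by rw [← he, ← he'])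
    · rw [mem_edges_inl] at he
      rw [he] at he'
      exact ((mem_inv_inl r p V E j).1 hq).2.2 i' k' ((mem_inv_inr r p V E hV _ _).1 hq') he'
    · rw [mem_edges_inl] at he'
      rw [he'] at he
      exact ((mem_inv_inl r p V E j').1 hq').2.2 i k ((mem_inv_inr r p V E hV _ _).1 hq) he
    · rw [mem_inv_inr r p V E hV] at hq hq'
      have b1 := edges_inr_bounds r hr p _ _ _ he
      have b2 := edges_inr_bounds r hr p _ _ _ he'
      rcases run_sep V hq hq' (fun h => hne (by rw [h])) with h | h
      · have := hsm h; omega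
      · have := hsm h; omega
  refine ⟨⟨?_, ?_, ?_⟩, ?_⟩
  · rintro (j | ⟨i, k⟩) hq
    · exact (validElt_inl r hr p j).2 ((mem_inv_inl r p V E j).1 hq).1
    · rw [mem_inv_inr r p V E hV] at hq
      exact (validElt_inr r hr p i k).2 ⟨hq.1, run_le _ _ _ _ hV hq⟩
  · intro q hq q' hq' hne
    rw [Finset.disjoint_left]
    intro e he he'
    exact key q hq q' hq' hne e he he'
  · intro i k i' k' hm hm'
    rw [mem_inv_inr r p V E hV] at hm hm'
    constructor
    · rintro rfl
      exact hm.2.2.1 (hm'.2.1 (Finset.mem_Ioc.2 ⟨hm'.1, le_rfl⟩))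
    · rintro rfl
      exact hm'.2.2.1 (hm.2.1 (Finset.mem_Ioc.2 ⟨hm.1, le_rfl⟩))
  · intro i k m w hm hgr
    rw [mem_inv_inr r p V E hV] at hm
    obtain ⟨t, hfb, htk, hprec⟩ := green_FB r hr p i k m w hgr
    have h2 := hc.2 i t hfb hm.2.2.1
      ((Finset.Ioc_subset_Ioc_right htk).trans hm.2.1)
    rw [Finset.not_subset] at h2
    obtain ⟨e, he, heE⟩ := h2
    refine ⟨e, by rw [hprec]; exact he, inv_cover r p V E hV e ?_ heE⟩
    rw [Finset.mem_Ioc] at he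
    have h3 := run_le _ _ _ _ hV hm
    have h4 := hsm.monotone (show i ≤ gg r (p + 1) by have := hm.1; omega)
    rw [vv_top r hr] at h4
    omega

theorem Vof_inv (r p : ℕ) (V E : Finset ℕ)
    (hV : V ⊆ Finset.Icc 1 (gg r (p + 1))) : Vof (inv r p V E) = V := by
  ext v
  rw [mem_Vof]
  constructor
  · rintro ⟨i, k, hm, h1, h2⟩
    rw [mem_inv_inr r p V E hV] at hm
    exact hm.2.1 (Finset.mem_Ioc.2 ⟨h1, h2⟩)
  · intro hv
    obtain ⟨i, k, h1, h2⟩ := run_exists V _ v hV hv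
    exact ⟨i, k, (mem_inv_inr r p V E hV i k).2 h1, h2⟩

theorem vv_between (r p i k e : ℕ) (h1 : vv r p i < e) (h2 : e ≤ vv r p k) (hik : i < k) :
    ∃ u, i < u ∧ u ≤ k ∧ vv r p (u - 1) < e ∧ e ≤ vv r p u := by
  have hex : ∃ u, i < u ∧ e ≤ vv r p u := ⟨k, hik, h2⟩
  have hs := Nat.find_spec hex
  refine ⟨Nat.find hex, hs.1, Nat.find_min' hex ⟨hik, h2⟩, ?_, hs.2⟩
  by_cases hi : i = Nat.find hex - 1
  · rw [← hi]; exact h1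
  · have := Nat.find_min hex (show Nat.find hex - 1 < Nat.find hex by omega)
    by_contra hc
    exact this ⟨by omega, by omega⟩

theorem Eof_inv (r : ℕ) (hr : 2 ≤ r) (p : ℕ) (V E : Finset ℕ)
    (hV : V ⊆ Finset.Icc 1 (gg r (p + 1))) (hE : E ⊆ Finset.Icc 1 (gg r (p + 2)))
    (hc : compat r p V E) : Eof r p (inv r p V E) = E := by
  ext e
  simp only [Eof, Finset.mem_sdiff, Finset.mem_Icc, Finset.mem_biUnion]
  constructor
  · rintro ⟨h1, h2⟩
    by_contra h3
    exact h2 (inv_cover r p V E hV e h1 h3)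
  · intro he
    refine ⟨Finset.mem_Icc.1 (hE he), ?_⟩
    rintro ⟨j | ⟨i, k⟩, hq, heq⟩
    · rw [mem_edges_inl] at heq
      rw [heq] at he
      exact ((mem_inv_inl r p V E j).1 hq).2.1 he
    · rw [mem_inv_inr r p V E hV] at hq
      rw [mem_edges_inr r hr] at heq
      rcases heq with ⟨h1, h2⟩ | ⟨hred, h1, h2⟩
      · obtain ⟨u, a1, a2, a3, a4⟩ := vv_between r p i k e h1 h2 hq.1
        exact hc.1 u (hq.2.1 (Finset.mem_Ioc.2 ⟨a1, a2⟩)) e he a3 a4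
      · obtain ⟨t, hfb, htk, hN⟩ := red_FB r hr p i k hred
        refine hc.2 i t hfb hq.2.2.1 ((Finset.Ioc_subset_Ioc_right htk).trans hq.2.1) ?_
        intro x hx
        rw [Finset.mem_Ioc, hN] at hx
        rw [show x = e by omega]; exact he

theorem B1_eq (r : ℕ) (hr : 2 ≤ r) (p : ℕ) (β : Finset Elt)
    (h : validColl r (p + 4) β) : B1 β = (Vof β).card := by
  unfold B1 Vof
  rw [Finset.card_biUnion]
  · refine Finset.sum_congr rfl ?_
    rintro (j | ⟨i, k⟩) _
    · simp [wt1, eltV]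
    · simp [wt1, eltV]
  · rintro (j | ⟨i, k⟩) hq (j' | ⟨i', k'⟩) hq' hne
    · exact Finset.disjoint_empty_left _
    · exact Finset.disjoint_empty_left _
    · exact Finset.disjoint_empty_right _
    · have h1 := valid_inr_run r hr p β h _ _ hq
      have h2 := valid_inr_run r hr p β h _ _ hq'
      have h3 := run_sep _ h1 h2 (fun h => hne (by rw [h]))
      change Disjoint (Finset.Ioc i k) (Finset.Ioc i' k')
      rw [Finset.disjoint_left]
      intro x hx hx'
      rw [Finset.mem_Ioc] at hx hx'
      omega

theorem B2_eq (r : ℕ) (hr : 2 ≤ r) (p : ℕ) (β : Finset Elt)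
    (h : validColl r (p + 4) β) :
    (Eof r p β).card + B2 r (p + 4) β = gg r (p + 2) := by
  have hsm := vv_strictMono r hr p
  have hsub : β.biUnion (edges r (p + 4)) ⊆ Finset.Icc 1 (gg r (p + 2)) := by
    intro e he
    rw [Finset.mem_Icc]
    obtain ⟨j | ⟨i, k⟩, hq, heq⟩ := Finset.mem_biUnion.1 he
    · rw [mem_edges_inl] at heq
      rw [heq]
      exact (validElt_inl r hr p j).1 (h.1 _ hq)
    · have hval := (validElt_inr r hr p i k).1 (h.1 _ hq)
      have h4 := hsm.monotone hval.2
      rw [vv_top r hr] at h4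
      rw [mem_edges_inr r hr] at heq
      rcases heq with ⟨h1, h2⟩ | ⟨hred, h1, h2⟩
      · omega
      · obtain ⟨t, hfb, htk, hN⟩ := red_FB r hr p i k hred
        have := hsm (show 0 < i from FB_pos r p i t hfb)
        omega
  unfold Eof B2
  rw [Finset.card_sdiff_add_card_eq_card hsub, Nat.card_Icc]
  omega

/-- The index set of pairs -/
noncomputable def pairs (r p : ℕ) : Finset (Finset ℕ × Finset ℕ) :=
  ((Finset.Icc 1 (gg r (p + 1))).powerset ×ˢ (Finset.Icc 1 (gg r (p + 2))).powerset).filter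
    (fun VE => compat r p VE.1 VE.2)

theorem mem_pairs (r p : ℕ) (V E : Finset ℕ) : (V, E) ∈ pairs r p ↔
    (V ⊆ Finset.Icc 1 (gg r (p + 1)) ∧ E ⊆ Finset.Icc 1 (gg r (p + 2))) ∧ compat r p V E := by
  simp [pairs]

theorem bij_FD (r : ℕ) (hr : 2 ≤ r) (p : ℕ) :
    Set.BijOn (fun β => (Vof β, Eof r p β)) (FD r (p + 4)) (pairs r p : Set _) := by
  refine Set.InvOn.bijOn (f' := fun VE => inv r p VE.1 VE.2) ⟨?_, ?_⟩ ?_ ?_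
  · intro β hβ
    exact inv_left r hr p β hβ.1 (Vof_subset r hr p β hβ.1)
  · rintro ⟨V, E⟩ h
    rw [Finset.mem_coe, mem_pairs] at h
    exact Prod.ext (Vof_inv r p V E h.1.1) (Eof_inv r hr p V E h.1.1 h.1.2 h.2)
  · intro β hβ
    rw [Finset.mem_coe, mem_pairs]
    exact ⟨⟨Vof_subset r hr p β hβ.1, Finset.sdiff_subset⟩, compat_of_FD r hr p β hβ⟩
  · rintro ⟨V, E⟩ h
    rw [Finset.mem_coe, mem_pairs] at h
    exact inv_FD r hr p V E h.1.1 h.2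

theorem finsum_FD (r : ℕ) (hr : 2 ≤ r) (p : ℕ) (a b : K) :
    (∑ᶠ β ∈ FD r (p + 4), a ^ ((r : ℤ) * (B1 β : ℤ)) *
      b ^ ((r : ℤ) * (c r (p + 4 - 1) - (B2 r (p + 4) β : ℤ)))) = Zs r p a b := by
  rw [finsum_mem_eq_of_bijOn (fun β => (Vof β, Eof r p β)) (bij_FD r hr p)
    (g := fun VE => a ^ (r * VE.1.card) * (b ^ r) ^ VE.2.card), finsum_mem_coe_finset]
  · unfold Zs SB pairs
    rw [Finset.sum_filter, Finset.sum_product]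
    refine Finset.sum_congr rfl fun V _ => ?_
    rw [Finset.mul_sum, Finset.sum_filter]
  · intro β hβ
    have h1 := B1_eq r hr p β hβ.1
    have h2 := B2_eq r hr p β hβ.1
    have e2 : c r (p + 4 - 1) = gg r (p + 2) := (gg_cast r hr (p + 2)).symm
    have h3 : c r (p + 4 - 1) - (B2 r (p + 4) β : ℤ) = ((Eof r p β).card : ℤ) := by
      rw [e2]; omega
    simp only
    rw [h3, h1, ← pow_mul, ← zpow_natCast, ← zpow_natCast]
    push_cast
    rfl

/-! ### Part 6: nonvanishing and the final statement -/

/-- evaluation at `(1,1)` -/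
noncomputable def ev : MvPolynomial (Fin 2) ℚ →+* ℚ := MvPolynomial.eval (fun _ => 1)

/-- fractions of polynomials with positive values at `(1,1)` -/
def PosK (x : K) : Prop :=
  ∃ f g : MvPolynomial (Fin 2) ℚ, 0 < ev f ∧ 0 < ev g ∧
    x * algebraMap _ K g = algebraMap _ K f

theorem algMap_ne (g : MvPolynomial (Fin 2) ℚ) (hg : 0 < ev g) :
    algebraMap (MvPolynomial (Fin 2) ℚ) K g ≠ 0 := by
  intro h
  rw [IsFractionRing.to_map_eq_zero_iff] at h
  rw [h, map_zero] at hg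
  exact lt_irrefl _ hg

theorem PosK.ne_zero {x : K} (h : PosK x) : x ≠ 0 := by
  obtain ⟨f, g, hf, hg, hx⟩ := h
  rintro rfl
  rw [zero_mul] at hx
  exact algMap_ne f hf hx.symm

theorem PosK.mul {x y : K} (hx : PosK x) (hy : PosK y) : PosK (x * y) := by
  obtain ⟨f, g, hf, hg, h⟩ := hx
  obtain ⟨f', g', hf', hg', h'⟩ := hy
  refine ⟨f * f', g * g', ?_, ?_, ?_⟩
  · rw [map_mul]; positivity
  · rw [map_mul]; positivity
  · rw [map_mul, map_mul, ← h, ← h']; ring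

theorem PosK.one : PosK 1 := ⟨1, 1, by simp, by simp, by simp⟩

theorem PosK.pow {x : K} (hx : PosK x) (n : ℕ) : PosK (x ^ n) := by
  induction n with
  | zero => rw [pow_zero]; exact PosK.one
  | succ n ih => rw [pow_succ]; exact ih.mul hx

theorem PosK.add_one {x : K} (hx : PosK x) : PosK (x + 1) := by
  obtain ⟨f, g, hf, hg, h⟩ := hx
  refine ⟨f + g, g, ?_, hg, ?_⟩
  · rw [map_add]; positivity
  · rw [map_add, ← h]; ring

theorem PosK.of_mul {x y : K} (hy : PosK y) (h : PosK (x * y)) : PosK x := by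
  have hy0 := hy.ne_zero
  obtain ⟨f, g, hf, hg, h⟩ := h
  obtain ⟨f', g', hf', hg', h'⟩ := hy
  refine ⟨f * g', g * f', ?_, ?_, ?_⟩
  · rw [map_mul]; positivity
  · rw [map_mul]; positivity
  · rw [map_mul, map_mul, ← h, ← h']; ring

theorem PosK.X (i : Fin 2) : PosK (algebraMap (MvPolynomial (Fin 2) ℚ) K (MvPolynomial.X i)) :=
  ⟨MvPolynomial.X i, 1, by simp [ev], by simp, by simp⟩

theorem PosK_seq (r : ℕ) (Y : ℕ → K) (h0 : PosK (Y 0)) (h1 : PosK (Y 1))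
    (hrec : ∀ m, Y (m + 2) * Y m = Y (m + 1) ^ r + 1) (m : ℕ) :
    PosK (Y m) ∧ PosK (Y (m + 1)) := by
  induction m with
  | zero => exact ⟨h0, h1⟩
  | succ m ih =>
    refine ⟨ih.2, ih.1.of_mul ?_⟩
    rw [show m + 1 + 1 = m + 2 from rfl, hrec]
    exact (ih.2.pow r).add_one

theorem cluster_expansion_formula (r : ℕ) (hr : 2 ≤ r) (X : ℤ → K)
    (hX1 : X 1 = x₁) (hX2 : X 2 = x₂)
    (hrec : ∀ m : ℤ, X (m + 1) * X (m - 1) = X m ^ r + 1)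
    (n : ℕ) (hn : 4 ≤ n) :
    X (n : ℤ) = x₁ ^ (-(c r (n - 1))) * x₂ ^ (-(c r (n - 2))) *
      ∑ᶠ β ∈ FD r n,
        x₁ ^ ((r : ℤ) * (B1 β : ℤ)) * x₂ ^ ((r : ℤ) * (c r (n - 1) - (B2 r (n) β : ℤ))) := by
  obtain ⟨p, rfl⟩ : ∃ p, n = p + 4 := ⟨n - 4, by omega⟩
  rw [finsum_FD r hr p]
  obtain ⟨Y, hYd⟩ : ∃ Y : ℕ → K, ∀ k, Y k = X ((k : ℤ) + 1) := ⟨_, fun _ => rfl⟩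
  have hY : ∀ m : ℕ, Y (m + 2) * Y m = Y (m + 1) ^ r + 1 := by
    intro m
    have := hrec ((m : ℤ) + 2)
    rw [hYd, hYd, hYd]
    push_cast
    convert this using 3 <;> ring_nf
  have e0 : Y 0 = x₁ := by rw [hYd]; simp [hX1]
  have e1 : Y 1 = x₂ := by
    rw [hYd, ← hX2]; norm_num
  have hpos := PosK_seq r Y (by rw [e0]; exact PosK.X 0) (by rw [e1]; exact PosK.X 1) hY
  have hmain := main_ind r hr p Y (fun m => (hpos m).1.ne_zero) hY
  rw [e0, e1] at hmain
  rw [← hmain]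
  have g1 : c r (p + 4 - 1) = gg r (p + 2) := (gg_cast r hr (p + 2)).symm
  have g2 : c r (p + 4 - 2) = gg r (p + 1) := (gg_cast r hr (p + 1)).symm
  have hx1 : x₁ ≠ 0 := (PosK.X 0).ne_zero
  have hx2 : x₂ ≠ 0 := (PosK.X 1).ne_zero
  rw [g1, g2, zpow_neg, zpow_neg, zpow_natCast, zpow_natCast]
  have hXe : Y (p + 3) = X ((p + 4 : ℕ) : ℤ) := by
    rw [hYd]
    congr 1
  rw [hXe]
  field_simp

end CF
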